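/- arXiv:0910.5829 — 4 statements merged into one kernel-verified Lean document; each statement's English description precedes it below -/
import Mathlib

section
/- Let α ∈ (0,2) with α ≠ 1, and for n ∈ ℕ define w_n(α) = (−1)^n · (∏_{j=0}^{n−1} (α − j)) / n!. Then the series ∑_{n=0}^{∞} w_n(α) converges to 0; that is, the family (w_n(α))_{n∈ℕ} has sum 0. -/
open Real

/-- The Grünwald–Letnikov weight `w_n(α) = (−1)^n (α choose n)`. -/
noncomputable def glWeight (α : ℝ) (n : ℕ) : ℝ :=
  (-1 : ℝ) ^ n * (∏ j ∈ Finset.range n, (α - j)) / (Nat.factorial n)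

theorem succ_mul_glWeight_succ (α : ℝ) (n : ℕ) :
    ((n : ℝ) + 1) * glWeight α (n + 1) = (n - α) * glWeight α n := by
  have h : ((n : ℝ) + 1) ≠ 0 := by positivity
  have h' : (n.factorial : ℝ) ≠ 0 := by positivity
  unfold glWeight
  rw [Finset.prod_range_succ, Nat.factorial_succ, pow_succ]
  push_cast
  field_simp
  ring

theorem mul_sum_range_glWeight (α : ℝ) (N : ℕ) :
    α * ∑ n ∈ Finset.range N, glWeight α n = -((N : ℝ) * glWeight α N) := by
  induction N with
  | zero => simp
  | succ N ih =>
    rw [Finset.sum_range_succ, mul_add, ih]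
    push_cast
    linear_combination succ_mul_glWeight_succ α N

theorem summable_abs_glWeight {α : ℝ} (h0 : 0 < α) (h2 : α ≤ 2) :
    Summable fun n => |glWeight α n| := by
  rw [← summable_nat_add_iff 2]
  have step (n : ℕ) : ((n : ℝ) + 3) * |glWeight α (n + 1 + 2)| =
      (n + 2 - α) * |glWeight α (n + 2)| := by
    have h := congrArg abs (succ_mul_glWeight_succ α (n + 2))
    have hn : (0 : ℝ) ≤ n := n.cast_nonneg
    push_cast at h
    rw [abs_mul, abs_mul, abs_of_nonneg (show (0 : ℝ) ≤ n + 2 + 1 by linarith),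
      abs_of_nonneg (show (0 : ℝ) ≤ n + 2 - α by linarith)] at h
    rw [show n + 1 + 2 = n + 2 + 1 by ring]
    linear_combination h
  have telescope (N : ℕ) : α * ∑ n ∈ Finset.range N, |glWeight α (n + 2)| =
      2 * |glWeight α 2| - (N + 2) * |glWeight α (N + 2)| := by
    induction N with
    | zero => simp
    | succ N ih =>
      rw [Finset.sum_range_succ, mul_add, ih]
      push_cast
      linear_combination step N
  refine summable_of_sum_range_le (c := 2 * |glWeight α 2| / α) (fun _ => abs_nonneg _)
    fun N => ?_
  rw [le_div_iff₀' h0, telescope]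
  have : 0 ≤ ((N : ℝ) + 2) * |glWeight α (N + 2)| := by positivity
  linarith

/-- If `f` is absolutely summable, the only possible limit of `n * f n` is `0`. -/
theorem eq_zero_of_tendsto_mul_of_summable_abs {f : ℕ → ℝ} {l : ℝ}
    (hf : Summable fun n => |f n|)
    (hl : Filter.Tendsto (fun n : ℕ => (n : ℝ) * f n) Filter.atTop (nhds l)) : l = 0 := by
  by_contra hne
  have hpos : 0 < |l| := abs_pos.mpr hne
  refine Real.not_summable_natCast_inv ?_
  refine summable_of_isBigO_nat hf (Asymptotics.IsBigO.of_bound (2 / |l|) ?_)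
  filter_upwards [hl.abs.eventually_const_lt (half_lt_self hpos),
    Filter.eventually_gt_atTop 0] with n hn hn0
  have hn0' : (0 : ℝ) < n := by exact_mod_cast hn0
  rw [abs_mul, abs_of_pos hn0'] at hn
  rw [norm_inv, Real.norm_eq_abs, Real.norm_eq_abs, abs_abs, abs_of_pos hn0',
    inv_le_iff_one_le_mul₀ hn0', div_mul_eq_mul_div, div_mul_eq_mul_div, le_div_iff₀ hpos]
  linarith

/-- For `α ∈ (0,2)`, `α ≠ 1`, the series `∑_{n=0}^∞ w_n(α)` of Grünwald–Letnikov
weights converges to 0. -/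
theorem stmt4 (α : ℝ) (hα : α ∈ Set.Ioo (0 : ℝ) 2) (hα1 : α ≠ 1) :
    HasSum (fun n : ℕ => glWeight α n) 0 := by
  have habs := summable_abs_glWeight hα.1 hα.2.le
  have hsum : HasSum (fun n => glWeight α n) (∑' n, glWeight α n) := habs.of_abs.hasSum
  have hlim := (hsum.tendsto_sum_nat.const_mul α).neg
  simp only [mul_sum_range_glWeight, neg_neg] at hlim
  have h := eq_zero_of_tendsto_mul_of_summable_abs habs hlim
  rwa [(mul_eq_zero.mp (neg_eq_zero.mp h)).resolve_left hα.1.ne'] at hsum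
end

section
/- Let α ∈ (1,2) and θ ∈ (0, 2π). Then the series ∑_{n=1}^{∞} (Γ(n+1−α)/Γ(n+2)) e^{inθ} converges (in ℂ) and its sum equals e^{−iθ} Γ(−α) [ (1 − e^{iθ})^α − 1 + α e^{iθ} ], where (1 − e^{iθ})^α denotes the principal complex power and Γ(−α) is the (real) Gamma function evaluated at −α (which is defined since −α is not a nonpositive integer). -/
open Real Complex

theorem Ring.choose_succ_mul {K : Type*} [Field K] [CharZero K] (a : K) (k : ℕ) :
    Ring.choose a (k + 1) * (k + 1) = Ring.choose a k * (a - k) := by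
  have h1 : ((k : K) + 1) ≠ 0 := by exact_mod_cast k.succ_ne_zero
  have h2 : (k.factorial : K) ≠ 0 := by exact_mod_cast k.factorial_ne_zero
  rw [Ring.choose_eq_smul, Ring.choose_eq_smul, descPochhammer_succ_right, Polynomial.smeval_mul,
    Nat.factorial_succ]
  simp only [smul_eq_mul, Polynomial.smeval_sub, Polynomial.smeval_X, Polynomial.smeval_natCast,
    pow_zero, pow_one, nsmul_eq_mul, mul_one]
  push_cast
  field_simp

theorem Real.Gamma_sub_div_Gamma_eq_choose {a : ℝ} (ha : ∀ m : ℕ, a ≠ m) (k : ℕ) :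
    Real.Gamma (k - a) / Real.Gamma (k + 1) =
      Real.Gamma (-a) * ((-1) ^ k * Ring.choose a k) := by
  induction k with
  | zero => simp
  | succ k ih =>
    have h1 : ((k : ℝ) + 1) ≠ 0 := by positivity
    have h2 : (k : ℝ) - a ≠ 0 := sub_ne_zero.2 (ha k).symm
    have h3 : Real.Gamma ((k : ℝ) + 1) ≠ 0 := (Real.Gamma_pos_of_pos (by positivity)).ne'
    have h4 := Ring.choose_succ_mul a k
    push_cast
    rw [show (k : ℝ) + 1 - a = (k - a) + 1 by ring, Real.Gamma_add_one h2, Real.Gamma_add_one h1,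
      mul_div_mul_comm, ih, div_mul_eq_mul_div, div_eq_iff h1, pow_succ]
    linear_combination Real.Gamma (-a) * (-1) ^ k * h4

theorem Real.summable_Gamma_sub_div_Gamma {a : ℝ} (ha : 0 < a) {m : ℕ} (ham : a < m) :
    Summable fun n : ℕ => Real.Gamma ((n + m : ℕ) - a) / Real.Gamma ((n + m : ℕ) + 1) := by
  have hm : (0 : ℝ) < m := ha.trans ham
  have hG : ∀ n : ℕ, 0 < Real.Gamma ((n + m : ℕ) - a) := fun n =>
    Real.Gamma_pos_of_pos (by push_cast; have := n.cast_nonneg (α := ℝ); linarith)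
  have hpos : ∀ n : ℕ, (0 : ℝ) < (n + m : ℕ) := fun n => by push_cast; positivity
  have key : ∀ N : ℕ, ∑ n ∈ Finset.range N,
      Real.Gamma ((n + m : ℕ) - a) / Real.Gamma ((n + m : ℕ) + 1) =
      (Real.Gamma (m - a) / Real.Gamma m -
        Real.Gamma ((N + m : ℕ) - a) / Real.Gamma (N + m : ℕ)) / a := by
    intro N
    induction N with
    | zero => simp
    | succ N ih =>
      have h1 := (hpos N).ne'
      have h2 : ((N + m : ℕ) : ℝ) - a ≠ 0 := by
        push_cast; have := N.cast_nonneg (α := ℝ); linarith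
      have h3 := (Real.Gamma_pos_of_pos (hpos N)).ne'
      rw [Finset.sum_range_succ, ih, show ((N + 1 + m : ℕ) : ℝ) = (N + m : ℕ) + 1 by
        push_cast; ring, show ((N + m : ℕ) : ℝ) + 1 - a = ((N + m : ℕ) - a) + 1 by ring,
        Real.Gamma_add_one h1, Real.Gamma_add_one h2]
      generalize ((N + m : ℕ) : ℝ) = x at *
      field_simp
      ring
  refine summable_of_sum_range_le (c := Real.Gamma (m - a) / Real.Gamma m / a)
    (fun n => (div_pos (hG n) (Real.Gamma_pos_of_pos (by linarith [hpos n]))).le) fun N => ?_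
  rw [key]
  gcongr
  exact sub_le_self _ (div_pos (hG N) (Real.Gamma_pos_of_pos (hpos N))).le

theorem Complex.hasSum_one_sub_cpow (a : ℂ) {z : ℂ} (hz : ‖z‖ < 1) :
    HasSum (fun n : ℕ => (-1) ^ n * Ring.choose a n * z ^ n) ((1 - z) ^ a) := by
  have h := (Complex.one_add_cpow_hasFPowerSeriesOnBall_zero (a := a)).hasSum (y := -z)
    (by
      rw [Metric.mem_eball, edist_zero_right, enorm_neg, ← ofReal_norm]
      exact ENNReal.ofReal_lt_one.2 hz)
  simp only [binomialSeries_apply, List.ofFn_const, List.prod_replicate, smul_eq_mul] at h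
  convert! h using 2 with n
  · rw [neg_pow z]
    ring
  · ring

theorem Real.hasSum_Gamma_sub_div_Gamma_mul_pow {a : ℝ} (ha : a ∈ Set.Ioo (1 : ℝ) 2) {z : ℂ}
    (hz : ‖z‖ ≤ 1) (hz1 : z ≠ 1) :
    HasSum (fun n : ℕ =>
      ((Real.Gamma ((n + 2 : ℕ) - a) / Real.Gamma ((n + 2 : ℕ) + 1) : ℝ) : ℂ) * z ^ (n + 2))
      ((Real.Gamma (-a) : ℂ) * ((1 - z) ^ (a : ℂ) - 1 + a * z)) := by
  set c : ℕ → ℝ := fun n => Real.Gamma ((n + 2 : ℕ) - a) / Real.Gamma ((n + 2 : ℕ) + 1) with hc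
  have hcs : Summable c := Real.summable_Gamma_sub_div_Gamma (by linarith [ha.1])
    (by exact_mod_cast ha.2)
  have ham : ∀ m : ℕ, a ≠ m := by
    rintro m rfl
    have h1 : 1 < m := by exact_mod_cast ha.1
    have h2 : m < 2 := by exact_mod_cast ha.2
    omega
  have hbound : ∀ n (w : ℂ), ‖w‖ ≤ 1 → ‖(c n : ℂ) * w ^ (n + 2)‖ ≤ ‖c n‖ := fun n w hw => by
    rw [norm_mul, norm_pow, Complex.norm_real]
    exact mul_le_of_le_one_right (norm_nonneg _) (pow_le_one₀ (norm_nonneg _) hw)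
  have hinside : ∀ w : ℂ, ‖w‖ < 1 → HasSum (fun n : ℕ => (c n : ℂ) * w ^ (n + 2))
      ((Real.Gamma (-a) : ℂ) * ((1 - w) ^ (a : ℂ) - 1 + a * w)) := fun w hw => by
    have h := (hasSum_nat_add_iff' 2).2 (Complex.hasSum_one_sub_cpow a hw)
    simp only [Finset.sum_range_succ, Finset.sum_range_zero, Ring.choose_zero_right,
      Ring.choose_one_right] at h
    convert! h.mul_left (Real.Gamma (-a) : ℂ) using 1
    · ext n
      simp only [hc]
      rw [Real.Gamma_sub_div_Gamma_eq_choose ham]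
      push_cast [Complex.ofReal_choose]
      ring
    · ring
  have hcont : ContinuousOn (fun w : ℂ => ∑' n : ℕ, (c n : ℂ) * w ^ (n + 2))
      (Metric.closedBall 0 1) :=
    continuousOn_tsum (fun n => by fun_prop) hcs.norm
      fun n w hw => hbound n w (by simpa using hw)
  have hmem : 1 - z ∈ Complex.slitPlane := by
    rw [Complex.mem_slitPlane_iff]
    by_contra! hcon
    simp only [Complex.sub_re, Complex.one_re, Complex.sub_im, Complex.one_im] at hcon
    have him : z.im = 0 := by linarith [hcon.2]
    refine hz1 (Complex.ext ?_ (by simpa using him))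
    have := (Complex.re_le_norm z).trans hz
    rw [Complex.one_re]
    linarith [hcon.1]
  have hz_closure : z ∈ closure (Metric.ball (0 : ℂ) 1) := by
    rw [closure_ball _ one_ne_zero]; simpa using hz
  have hne := mem_closure_iff_nhdsWithin_neBot.1 hz_closure
  have hleft : Filter.Tendsto (fun w : ℂ => ∑' n : ℕ, (c n : ℂ) * w ^ (n + 2))
      (nhdsWithin z (Metric.ball 0 1)) (nhds (∑' n : ℕ, (c n : ℂ) * z ^ (n + 2))) :=
    (hcont z (by simpa using hz)).mono_left (nhdsWithin_mono _ Metric.ball_subset_closedBall)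
  have hright : Filter.Tendsto
      (fun w : ℂ => (Real.Gamma (-a) : ℂ) * ((1 - w) ^ (a : ℂ) - 1 + a * w))
      (nhdsWithin z (Metric.ball 0 1))
      (nhds ((Real.Gamma (-a) : ℂ) * ((1 - z) ^ (a : ℂ) - 1 + a * z))) := by
    have : ContinuousAt
      (fun w : ℂ => (Real.Gamma (-a) : ℂ) * ((1 - w) ^ (a : ℂ) - 1 + a * w)) z := by
      have := (continuousAt_const.sub continuousAt_id : ContinuousAt (fun w : ℂ => 1 - w) z).cpow
        (continuousAt_const (y := (a : ℂ))) hmem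
      fun_prop
    exact this.mono_left nhdsWithin_le_nhds
  have heq := tendsto_nhds_unique_of_eventuallyEq hleft hright
    (eventually_nhdsWithin_of_forall fun w hw => (hinside w (by simpa using hw)).tsum_eq)
  rw [← heq]
  exact (Summable.of_norm_bounded hcs.norm fun n => hbound n z hz).hasSum

/-- For `α ∈ (1,2)` and `θ ∈ (0,2π)`, the series `∑_{n=1}^∞ (Γ(n+1−α)/Γ(n+2)) e^{inθ}`
converges to `e^{−iθ} Γ(−α) [ (1−e^{iθ})^α − 1 + α e^{iθ} ]`, where the power is the
principal complex power. -/
theorem stmt7 (α θ : ℝ) (hα : α ∈ Set.Ioo (1 : ℝ) 2)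
    (hθ : θ ∈ Set.Ioo (0 : ℝ) (2 * Real.pi)) :
    HasSum
      (fun n : ℕ =>
        ((Real.Gamma (((n : ℝ) + 1) + 1 - α) / Real.Gamma (((n : ℝ) + 1) + 2) : ℝ) : ℂ) *
          Complex.exp (((n : ℝ) + 1) * θ * Complex.I))
      (Complex.exp (-(θ : ℂ) * Complex.I) * (Real.Gamma (-α) : ℂ) *
        ((1 - Complex.exp ((θ : ℂ) * Complex.I)) ^ (α : ℂ) - 1 +
          (α : ℂ) * Complex.exp ((θ : ℂ) * Complex.I))) := by
  have hne : Complex.exp (θ * Complex.I) ≠ 1 := by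
    intro h
    obtain ⟨k, hk⟩ := Complex.exp_eq_one_iff.1 h
    have hk' : θ = k * (2 * π) := by simpa using congrArg Complex.im hk
    have hpi := Real.two_pi_pos
    rw [hk'] at hθ
    have h0 : (0 : ℝ) < k := pos_of_mul_pos_left hθ.1 hpi.le
    have h1 : (k : ℝ) < 1 := by nlinarith [hθ.2]
    norm_cast at h0 h1
    omega
  have h := (Real.hasSum_Gamma_sub_div_Gamma_mul_pow hα
    (Complex.norm_exp_ofReal_mul_I θ).le hne).mul_left (Complex.exp (-(θ : ℂ) * Complex.I))
  rw [← mul_assoc] at h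
  convert! h using 2 with n
  rw [mul_left_comm, ← Complex.exp_nat_mul, ← Complex.exp_add]
  push_cast
  ring_nf
end

section
/- (Trench) Let f : (0, π) → ℝ be integrable and nonincreasing, with right limit M = lim_{θ→0+} f(θ) and left limit m = lim_{θ→π−} f(θ), where M and m are finite and M > m. For k ∈ ℕ set t_k = (1/π) ∫_0^π f(θ) cos(kθ) dθ, and for n ≥ 1 let T_n be the n×n real symmetric Toeplitz matrix with (T_n)_{ij} = t_{|i−j|}. Then for every n ≥ 1 the matrix T_n has n distinct real eigenvalues, and every eigenvalue of T_n lies in the open interval (m, M). -/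
open Real MeasureTheory

open Polynomial ComplexConjugate in
theorem eval_mul_conj_eval_add_neg {n : ℕ} {p q : ℂ[X]} (hp : p.natDegree < n)
    (hq : q.natDegree < n) (θ : ℝ) :
    p.eval (Complex.exp (θ * Complex.I)) * conj (q.eval (Complex.exp (θ * Complex.I))) +
      p.eval (Complex.exp (-θ * Complex.I)) * conj (q.eval (Complex.exp (-θ * Complex.I))) =
    ∑ i : Fin n, ∑ j : Fin n, ((2 * Real.cos ((((i : ℤ) - (j : ℤ)).natAbs : ℕ) * θ) : ℝ) : ℂ) *
      (p.coeff j * conj (q.coeff i)) := by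
  simp only [eval_eq_sum_range' hp, eval_eq_sum_range' hq, Finset.sum_range, map_sum, map_mul,
    map_pow, Finset.sum_mul_sum]
  simp only [← Finset.sum_add_distrib]
  rw [Finset.sum_comm]
  refine Finset.sum_congr rfl fun i _ => ?_
  refine Finset.sum_congr rfl fun j _ => ?_
  have hcos : Real.cos ((((i : ℤ) - (j : ℤ)).natAbs : ℕ) * θ) =
      Real.cos (((j : ℝ) - (i : ℝ)) * θ) := by
    rw [Nat.cast_natAbs, Int.cast_abs, ← Real.cos_neg (((j : ℝ) - (i : ℝ)) * θ), ← neg_mul, neg_sub]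
    push_cast
    rcases abs_choice ((i : ℝ) - (j : ℝ)) with h | h <;> rw [h]
    rw [neg_mul, Real.cos_neg]
  rw [hcos]
  push_cast
  rw [Complex.two_cos]
  simp only [← Complex.exp_conj, map_mul, map_neg, Complex.conj_ofReal, Complex.conj_I,
    ← Complex.exp_nat_mul]
  have h1 : Complex.exp ((j - i : ℂ) * θ * Complex.I) =
      Complex.exp (j * (θ * Complex.I)) * Complex.exp (i * (θ * -Complex.I)) := by
    rw [← Complex.exp_add]
    ring_nf
  have h2 : Complex.exp (-((j - i : ℂ) * θ) * Complex.I) =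
      Complex.exp (j * (-θ * Complex.I)) * Complex.exp (i * (-θ * -Complex.I)) := by
    rw [← Complex.exp_add]
    ring_nf
  rw [h1, h2]
  ring

theorem integral_cos_nat_mul (k : ℕ) :
    ∫ θ in (0 : ℝ)..Real.pi, Real.cos (k * θ) = if k = 0 then Real.pi else 0 := by
  split_ifs with h
  · simp [h]
  · have hk : (k : ℝ) ≠ 0 := by exact_mod_cast h
    rw [intervalIntegral.integral_comp_mul_left (fun x => Real.cos x) hk]
    simp [Real.sin_nat_mul_pi]

open Polynomial ComplexConjugate in
theorem integral_sub_mul_eval_eq_zero {f : ℝ → ℝ}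
    (hf_int : IntervalIntegrable f volume 0 Real.pi) {t : ℕ → ℝ}
    (ht : ∀ k : ℕ, t k = (1 / Real.pi) * ∫ θ in (0 : ℝ)..Real.pi, f θ * Real.cos (k * θ))
    {n : ℕ} {T : Matrix (Fin n) (Fin n) ℝ}
    (hT : ∀ i j : Fin n, T i j = t (Int.natAbs ((i : ℤ) - (j : ℤ)))) {μ : ℝ} {p q : ℂ[X]}
    (hp : p.natDegree < n) (hq : q.natDegree < n)
    (hev : ∀ i : Fin n, ∑ j : Fin n, (T i j : ℂ) * p.coeff j = μ * p.coeff i) :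
    ∫ θ in (0 : ℝ)..Real.pi, ((f θ - μ : ℝ) : ℂ) *
      (p.eval (Complex.exp (θ * Complex.I)) * conj (q.eval (Complex.exp (θ * Complex.I))) +
      p.eval (Complex.exp (-θ * Complex.I)) * conj (q.eval (Complex.exp (-θ * Complex.I)))) =
      0 := by
  have hint (k : ℕ) : IntervalIntegrable (fun θ => (f θ - μ) * (2 * Real.cos (k * θ))) volume
      0 Real.pi :=
    (hf_int.sub intervalIntegrable_const).mul_continuousOn (by fun_prop)
  have hintC (k : ℕ) (c : ℂ) : IntervalIntegrable
      (fun θ => (((f θ - μ) * (2 * Real.cos (k * θ)) : ℝ) : ℂ) * c) volume 0 Real.pi := by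
    refine IntervalIntegrable.mul_const ?_ c
    exact ⟨(hint k).1.ofReal, (hint k).2.ofReal⟩
  have hval (i j : Fin n) : ∫ θ in (0 : ℝ)..Real.pi,
      (f θ - μ) * (2 * Real.cos ((((i : ℤ) - (j : ℤ)).natAbs : ℕ) * θ)) =
      2 * Real.pi * (T i j - if i = j then μ else 0) := by
    have h1 : ∀ k : ℕ, ∫ θ in (0 : ℝ)..Real.pi, (f θ - μ) * (2 * Real.cos (k * θ)) =
        2 * (∫ θ in (0 : ℝ)..Real.pi, f θ * Real.cos (k * θ)) -
          2 * μ * ∫ θ in (0 : ℝ)..Real.pi, Real.cos (k * θ) := by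
      intro k
      rw [← intervalIntegral.integral_const_mul, ← intervalIntegral.integral_const_mul,
        ← intervalIntegral.integral_sub]
      · exact intervalIntegral.integral_congr fun θ _ => by ring
      · exact (hf_int.mul_continuousOn (by fun_prop)).const_mul 2
      · exact Continuous.intervalIntegrable (by fun_prop) _ _
    have hij : ((i : ℤ) - (j : ℤ)).natAbs = 0 ↔ i = j := by
      rw [Int.natAbs_eq_zero, Fin.ext_iff]
      omega
    rw [h1, integral_cos_nat_mul, hT, ht]
    simp only [hij]
    have := Real.pi_ne_zero
    split_ifs
    · field_simp
    · field_simp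
      ring
  simp only [eval_mul_conj_eval_add_neg hp hq, Finset.mul_sum, ← mul_assoc, ← Complex.ofReal_mul]
  simp only [mul_assoc ((_ : ℝ) : ℂ)]
  rw [intervalIntegral.integral_finsetSum fun i _ => ?_]
  · refine Finset.sum_eq_zero fun i _ => ?_
    rw [intervalIntegral.integral_finsetSum fun j _ => ?_]
    · calc _ = ∑ j : Fin n, 2 * Real.pi * conj (q.coeff i) *
            ((T i j : ℂ) * p.coeff j - if i = j then μ * p.coeff j else 0) := by
            refine Finset.sum_congr rfl fun j _ => ?_
            have := hval i j
            simp only [← mul_assoc] at this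
            rw [intervalIntegral.integral_mul_const, intervalIntegral.integral_ofReal, this]
            split_ifs <;> push_cast <;> ring
        _ = 0 := by
            rw [← Finset.mul_sum, Finset.sum_sub_distrib, hev]
            simp
    · simpa only [mul_assoc] using hintC _ (p.coeff j * conj (q.coeff i))
  · rw [← Finset.sum_fn]
    refine IntervalIntegrable.sum Finset.univ fun j _ => ?_
    simpa only [mul_assoc] using hintC _ (p.coeff j * conj (q.coeff i))

open Polynomial in
theorem finite_setOf_affine_cos_mul_normSq_eval_eq_zero {P : ℂ[X]} (hP : P ≠ 0) {α β : ℝ}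
    (hαβ : α ≠ 0 ∨ β ≠ 0) :
    {θ ∈ Set.Ioo 0 Real.pi | (α * Real.cos θ + β) *
      (Complex.normSq (P.eval (Complex.exp (θ * Complex.I))) +
        Complex.normSq (P.eval (Complex.exp (-θ * Complex.I)))) = 0}.Finite := by
  have h1 : {x : ℝ | α * x + β = 0}.Finite := by
    refine Set.Subsingleton.finite fun x hx y hy => ?_
    simp only [Set.mem_ofPred_eq] at hx hy
    by_cases hα : α = 0
    · simp_all
    · exact mul_left_cancel₀ hα (by linarith)
  have h2 : {z : ℂ | P.IsRoot z}.Finite := finite_setOfPred_isRoot hP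
  have h3 : (Set.Ioo 0 Real.pi ∩ Real.cos ⁻¹' ({x : ℝ | α * x + β = 0} ∪
      Complex.re '' {z : ℂ | P.IsRoot z})).Finite := by
    refine Set.Finite.of_finite_image (f := Real.cos)
      ((h1.union (h2.image Complex.re)).subset ?_) ?_
    · rintro _ ⟨θ, hθ, rfl⟩
      exact hθ.2
    · exact Real.injOn_cos.mono (Set.inter_subset_left.trans Set.Ioo_subset_Icc_self)
  refine h3.subset ?_
  rintro θ ⟨hθ, h0⟩
  refine ⟨hθ, ?_⟩
  rcases mul_eq_zero.1 h0 with h | h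
  · exact Or.inl h
  · refine Or.inr ⟨Complex.exp (θ * Complex.I), ?_, Complex.exp_ofReal_mul_I_re θ⟩
    refine Complex.normSq_eq_zero.1 (le_antisymm ?_ (Complex.normSq_nonneg _))
    linarith [Complex.normSq_nonneg (P.eval (Complex.exp (-θ * Complex.I)))]

theorem integral_sub_mul_ne_zero {f : ℝ → ℝ}
    (hf_int : IntervalIntegrable f volume 0 Real.pi) {M m μ : ℝ}
    (hM : Filter.Tendsto f (nhdsWithin 0 (Set.Ioi 0)) (nhds M))
    (hm : Filter.Tendsto f (nhdsWithin Real.pi (Set.Iio Real.pi)) (nhds m))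
    (hMm : m < M) {s : ℝ → ℝ} (hs : Continuous s)
    (hfin : {θ ∈ Set.Ioo 0 Real.pi | s θ = 0}.Finite)
    (hnonneg : ∀ θ ∈ Set.Ioo 0 Real.pi, 0 ≤ (f θ - μ) * s θ) :
    ∫ θ in (0 : ℝ)..Real.pi, (f θ - μ) * s θ ≠ 0 := by
  intro h0
  have hint : IntervalIntegrable (fun θ => (f θ - μ) * s θ) volume 0 Real.pi :=
    (hf_int.sub intervalIntegrable_const).mul_continuousOn hs.continuousOn
  rw [intervalIntegral.integral_of_le Real.pi_pos.le, integral_Ioc_eq_integral_Ioo,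
    setIntegral_eq_zero_iff_of_nonneg_ae] at h0
  · have hae : ∀ᵐ θ, θ ∈ Set.Ioo 0 Real.pi → f θ = μ := by
      have hz : ∀ᵐ θ : ℝ, θ ∉ {θ ∈ Set.Ioo 0 Real.pi | s θ = 0} :=
        measure_eq_zero_iff_ae_notMem.1 (hfin.measure_zero volume)
      filter_upwards [(ae_restrict_iff' measurableSet_Ioo).1 h0, hz] with θ h1 h2 hθ
      rcases mul_eq_zero.1 (h1 hθ) with h | h
      · linarith
      · exact absurd ⟨hθ, h⟩ h2
    have key {a b : ℝ} (ha : 0 ≤ a) (hab : a < b) (hb : b ≤ Real.pi) :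
        ∃ θ ∈ Set.Ioo a b, f θ = μ := by
      by_contra! hne
      have : volume (Set.Ioo a b) = 0 := by
        refine measure_eq_zero_iff_ae_notMem.2 ?_
        filter_upwards [hae] with θ h1 h2
        exact hne θ h2 (h1 ⟨ha.trans_lt h2.1, h2.2.trans_le hb⟩)
      simp [Real.volume_Ioo] at this
      linarith
    have hMμ : M = μ := by
      by_contra hne
      obtain ⟨u, hu, hu'⟩ := (mem_nhdsGT_iff_exists_Ioo_subset' Real.pi_pos).1
        (hM.eventually_ne hne)
      obtain ⟨θ, hθ, h⟩ := key le_rfl (lt_min hu Real.pi_pos) (min_le_right u _)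
      exact hu' ⟨hθ.1, hθ.2.trans_le (min_le_left _ _)⟩ h
    have hmμ : m = μ := by
      by_contra hne
      obtain ⟨u, hu, hu'⟩ := (mem_nhdsLT_iff_exists_Ioo_subset' Real.pi_pos).1
        (hm.eventually_ne hne)
      obtain ⟨θ, hθ, h⟩ := key (le_max_right u 0) (max_lt hu Real.pi_pos) le_rfl
      exact hu' ⟨(le_max_left _ _).trans_lt hθ.1, hθ.2⟩ h
    linarith
  · exact (ae_restrict_iff' measurableSet_Ioo).2 (Filter.Eventually.of_forall hnonneg)
  · exact hint.1.mono_set Set.Ioo_subset_Ioc_self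

theorem exists_sub_mul_cos_sub_cos_nonneg {f : ℝ → ℝ}
    (hf : AntitoneOn f (Set.Ioo 0 Real.pi)) (μ : ℝ) :
    ∃ θ₀ : ℝ, ∀ θ ∈ Set.Ioo 0 Real.pi, 0 ≤ (f θ - μ) * (Real.cos θ - Real.cos θ₀) := by
  set S := {θ ∈ Set.Ioo 0 Real.pi | μ < f θ} with hS
  have hbdd : BddAbove S := ⟨Real.pi, fun θ hθ => hθ.1.2.le⟩
  have h0 : 0 ≤ sSup S := Real.sSup_nonneg fun θ hθ => hθ.1.1.le
  have hpi : sSup S ≤ Real.pi := Real.sSup_le (fun θ hθ => hθ.1.2.le) Real.pi_pos.le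
  refine ⟨sSup S, fun θ hθ => ?_⟩
  rcases lt_or_ge θ (sSup S) with h | h
  · obtain ⟨x, hx, hxθ⟩ := exists_lt_of_lt_csSup (Set.nonempty_iff_ne_empty.2 fun he => by
      rw [he, Real.sSup_empty] at h
      exact (hθ.1.trans h).false) h
    have h1 := hf hθ hx.1 hxθ.le
    have h2 := Real.cos_le_cos_of_nonneg_of_le_pi hθ.1.le hpi h.le
    exact mul_nonneg (by linarith [hx.2]) (by linarith)
  · have h2 := Real.cos_le_cos_of_nonneg_of_le_pi h0 hθ.2.le h
    rcases h.eq_or_lt with h | h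
    · simp [h]
    · have h1 : f θ ≤ μ := not_lt.1 fun hlt => h.not_ge (le_csSup hbdd ⟨hθ, hlt⟩)
      exact mul_nonneg_of_nonpos_of_nonpos (by linarith) (by linarith)

open Polynomial ComplexConjugate in
theorem false_of_eval_mul_conj_eval_eq {f : ℝ → ℝ}
    (hf_int : IntervalIntegrable f volume 0 Real.pi) {M m μ : ℝ}
    (hM : Filter.Tendsto f (nhdsWithin 0 (Set.Ioi 0)) (nhds M))
    (hm : Filter.Tendsto f (nhdsWithin Real.pi (Set.Iio Real.pi)) (nhds m))
    (hMm : m < M) {t : ℕ → ℝ}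
    (ht : ∀ k : ℕ, t k = (1 / Real.pi) * ∫ θ in (0 : ℝ)..Real.pi, f θ * Real.cos (k * θ))
    {n : ℕ} {T : Matrix (Fin n) (Fin n) ℝ}
    (hT : ∀ i j : Fin n, T i j = t (Int.natAbs ((i : ℤ) - (j : ℤ)))) {p q P : ℂ[X]}
    (hp : p.natDegree < n) (hq : q.natDegree < n)
    (hev : ∀ i : Fin n, ∑ j : Fin n, (T i j : ℂ) * p.coeff j = μ * p.coeff i)
    (hP : P ≠ 0) {α β : ℝ} (hαβ : α ≠ 0 ∨ β ≠ 0) {c : ℂ} (hc : c ≠ 0)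
    (hpq : ∀ θ : ℝ, p.eval (Complex.exp (θ * Complex.I)) *
      conj (q.eval (Complex.exp (θ * Complex.I))) =
      c * ((α * Real.cos θ + β : ℝ) : ℂ) * Complex.normSq (P.eval (Complex.exp (θ * Complex.I))))
    (hnonneg : ∀ θ ∈ Set.Ioo 0 Real.pi, 0 ≤ (f θ - μ) * (α * Real.cos θ + β)) : False := by
  have h0 := integral_sub_mul_eval_eq_zero hf_int ht hT hp hq hev
  have hpq' (θ : ℝ) := hpq (-θ)
  simp only [Complex.ofReal_neg, Real.cos_neg] at hpq'
  simp only [hpq, hpq'] at h0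
  refine integral_sub_mul_ne_zero hf_int (μ := μ) hM hm hMm
    (s := fun θ => (α * Real.cos θ + β) *
      (Complex.normSq (P.eval (Complex.exp (θ * Complex.I))) +
        Complex.normSq (P.eval (Complex.exp (-θ * Complex.I))))) ?_
    (finite_setOf_affine_cos_mul_normSq_eval_eq_zero hP hαβ) (fun θ hθ => ?_) ?_
  · have := Complex.continuous_normSq
    fun_prop
  · rw [← mul_assoc]
    exact mul_nonneg (hnonneg θ hθ) (add_nonneg (Complex.normSq_nonneg _) (Complex.normSq_nonneg _))
  · refine Complex.ofReal_eq_zero.1 ((mul_eq_zero.1 (Eq.trans ?_ h0)).resolve_left hc)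
    rw [← intervalIntegral.integral_ofReal, ← intervalIntegral.integral_const_mul]
    refine intervalIntegral.integral_congr fun θ _ => ?_
    push_cast
    ring

open Polynomial ComplexConjugate in
theorem sub_mul_conj_sub_conj_exp (θ θ₀ : ℝ) :
    (Complex.exp (θ * Complex.I) - Complex.exp (θ₀ * Complex.I)) *
      conj (Complex.exp (θ * Complex.I) - conj (Complex.exp (θ₀ * Complex.I))) =
    -2 * Complex.exp (θ₀ * Complex.I) * ((1 * Real.cos θ + -Real.cos θ₀ : ℝ) : ℂ) := by
  have h (x : ℝ) : Complex.exp (x * Complex.I) * conj (Complex.exp (x * Complex.I)) = 1 := by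
    rw [Complex.mul_conj, Complex.normSq_eq_norm_sq, Complex.norm_exp_ofReal_mul_I]
    simp
  have hc (x : ℝ) : 2 * (Real.cos x : ℂ) =
      Complex.exp (x * Complex.I) + conj (Complex.exp (x * Complex.I)) := by
    rw [Complex.add_conj, Complex.exp_ofReal_mul_I_re]
    push_cast
    rfl
  have h1 := h θ
  have h2 := h θ₀
  have h3 := hc θ
  have h4 := hc θ₀
  push_cast at h3 h4 ⊢
  simp only [map_sub, Complex.conj_conj]
  linear_combination h1 - h2 + Complex.exp (θ₀ * Complex.I) * h3 -
    Complex.exp (θ₀ * Complex.I) * h4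

open Polynomial ComplexConjugate in
theorem lt_and_lt_of_forall_sum_mul_coeff_eq {f : ℝ → ℝ}
    (hf_int : IntervalIntegrable f volume 0 Real.pi)
    (hf_mono : AntitoneOn f (Set.Ioo 0 Real.pi)) {M m μ : ℝ}
    (hM : Filter.Tendsto f (nhdsWithin 0 (Set.Ioi 0)) (nhds M))
    (hm : Filter.Tendsto f (nhdsWithin Real.pi (Set.Iio Real.pi)) (nhds m))
    (hMm : m < M) {t : ℕ → ℝ}
    (ht : ∀ k : ℕ, t k = (1 / Real.pi) * ∫ θ in (0 : ℝ)..Real.pi, f θ * Real.cos (k * θ))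
    {n : ℕ} {T : Matrix (Fin n) (Fin n) ℝ}
    (hT : ∀ i j : Fin n, T i j = t (Int.natAbs ((i : ℤ) - (j : ℤ)))) {p : ℂ[X]}
    (hp : p.natDegree < n) (hp0 : p ≠ 0)
    (hev : ∀ i : Fin n, ∑ j : Fin n, (T i j : ℂ) * p.coeff j = μ * p.coeff i) :
    m < μ ∧ μ < M := by
  have hle (θ : ℝ) (hθ : θ ∈ Set.Ioo 0 Real.pi) : m ≤ f θ ∧ f θ ≤ M := by
    refine ⟨le_of_tendsto hm ?_, ge_of_tendsto hM ?_⟩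
    · filter_upwards [Ioo_mem_nhdsLT hθ.2] with x hx
      exact hf_mono hθ ⟨hθ.1.trans hx.1, hx.2⟩ hx.1.le
    · filter_upwards [Ioo_mem_nhdsGT hθ.1] with x hx
      exact hf_mono ⟨hx.1, hx.2.trans hθ.2⟩ hθ hx.2.le
  constructor
  · by_contra! h
    refine false_of_eval_mul_conj_eval_eq hf_int hM hm hMm ht hT hp hp hev hp0
      (α := 0) (β := 1) (Or.inr one_ne_zero) one_ne_zero (fun θ => ?_) fun θ hθ => ?_
    · simp [Complex.mul_conj]
    · linarith [(hle θ hθ).1]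
  · by_contra! h
    refine false_of_eval_mul_conj_eval_eq hf_int hM hm hMm ht hT hp hp hev hp0
      (α := 0) (β := -1) (Or.inr (by norm_num)) (c := -1) (by norm_num) (fun θ => ?_)
      fun θ hθ => ?_
    · simp [Complex.mul_conj]
    · linarith [(hle θ hθ).2]

open Polynomial ComplexConjugate in
theorem exists_forall_eval_ne_zero {f : ℝ → ℝ}
    (hf_int : IntervalIntegrable f volume 0 Real.pi)
    (hf_mono : AntitoneOn f (Set.Ioo 0 Real.pi)) {M m : ℝ}
    (hM : Filter.Tendsto f (nhdsWithin 0 (Set.Ioi 0)) (nhds M))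
    (hm : Filter.Tendsto f (nhdsWithin Real.pi (Set.Iio Real.pi)) (nhds m))
    (hMm : m < M) {t : ℕ → ℝ}
    (ht : ∀ k : ℕ, t k = (1 / Real.pi) * ∫ θ in (0 : ℝ)..Real.pi, f θ * Real.cos (k * θ))
    {n : ℕ} {T : Matrix (Fin n) (Fin n) ℝ}
    (hT : ∀ i j : Fin n, T i j = t (Int.natAbs ((i : ℤ) - (j : ℤ)))) (μ : ℝ) :
    ∃ a : ℂ, ∀ p : ℂ[X], p.natDegree < n → p ≠ 0 →
      (∀ i : Fin n, ∑ j : Fin n, (T i j : ℂ) * p.coeff j = μ * p.coeff i) → p.eval a ≠ 0 := by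
  obtain ⟨θ₀, hθ₀⟩ := exists_sub_mul_cos_sub_cos_nonneg hf_mono μ
  refine ⟨Complex.exp (θ₀ * Complex.I), fun p hp hp0 hev hroot => ?_⟩
  obtain ⟨P, rfl⟩ := dvd_iff_isRoot.2 hroot
  have hP : P ≠ 0 := right_ne_zero_of_mul hp0
  have hq : ((X - C (conj (Complex.exp (θ₀ * Complex.I)))) * P).natDegree < n := by
    rwa [natDegree_mul (X_sub_C_ne_zero _) hP, natDegree_X_sub_C] at hp ⊢
  refine false_of_eval_mul_conj_eval_eq hf_int hM hm hMm ht hT hp hq hev hP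
    (α := 1) (β := -Real.cos θ₀) (Or.inl one_ne_zero) (c := -2 * Complex.exp (θ₀ * Complex.I))
    (by simp [Complex.exp_ne_zero]) (fun θ => ?_) fun θ hθ => ?_
  · rw [← sub_mul_conj_sub_conj_exp, ← Complex.mul_conj]
    simp only [eval_mul, eval_sub, eval_X, eval_C, map_mul]
    ring
  · rw [one_mul, ← sub_eq_add_neg]
    exact hθ₀ θ hθ

/-- (Trench 1993) Let `f` be integrable and nonincreasing on `(0,π)` with finite limits
`M = f(0+)` and `m = f(π−)` satisfying `M > m`. Let `t_k = (1/π)∫_0^π f(θ)cos(kθ)dθ` and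
let `T_n` be the n×n symmetric Toeplitz matrix `(T_n)_{ij} = t_{|i−j|}`. Then `T_n` has
`n` distinct real eigenvalues, all lying in the open interval `(m, M)`. -/
theorem stmt13 (f : ℝ → ℝ)
    (hf_int : IntervalIntegrable f volume 0 Real.pi)
    (hf_mono : AntitoneOn f (Set.Ioo 0 Real.pi))
    (M m : ℝ)
    (hM : Filter.Tendsto f (nhdsWithin 0 (Set.Ioi 0)) (nhds M))
    (hm : Filter.Tendsto f (nhdsWithin Real.pi (Set.Iio Real.pi)) (nhds m))
    (hMm : m < M)
    (t : ℕ → ℝ)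
    (ht : ∀ k : ℕ, t k = (1 / Real.pi) * ∫ θ in (0 : ℝ)..Real.pi, f θ * Real.cos (k * θ))
    (n : ℕ) (hn : 1 ≤ n)
    (T : Matrix (Fin n) (Fin n) ℝ)
    (hT : ∀ i j : Fin n, T i j = t (Int.natAbs ((i : ℤ) - (j : ℤ)))) :
    (spectrum ℝ T).ncard = n ∧ spectrum ℝ T ⊆ Set.Ioo m M := by
  classical
  have hH : T.IsHermitian := by
    ext i j
    rw [Matrix.conjTranspose_apply, star_trivial, hT, hT, ← Int.natAbs_neg, neg_sub]
  let e (v : Fin n → ℂ) : Polynomial ℂ := Polynomial.ofFn n v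
  have he_inj : ∀ v, e v = 0 → v = 0 := fun v hv =>
    Polynomial.injective_ofFn n (hv.trans (Polynomial.ofFn_zero n).symm)
  have he_deg (v : Fin n → ℂ) : (e v).natDegree < n := Polynomial.ofFn_natDegree_lt hn v
  have he_coeff (v : Fin n → ℂ) (i : Fin n) : (e v).coeff i = v i :=
    Polynomial.ofFn_coeff_eq_val_of_lt v i.2
  let b (i : Fin n) : Fin n → ℂ := fun k => (hH.eigenvectorBasis i k : ℂ)
  have hb (i k : Fin n) : ∑ j, (T k j : ℂ) * b i j = hH.eigenvalues i * b i k := by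
    have := congrFun (hH.mulVec_eigenvectorBasis i) k
    simp only [Matrix.mulVec, dotProduct, Pi.smul_apply, smul_eq_mul] at this
    simp only [b]
    exact_mod_cast this
  have hb_lin (i j : Fin n) (hij : i ≠ j) (x y : ℂ) (h : x • b i + y • b j = 0) :
      x = 0 ∧ y = 0 := by
    have hort (l l' : Fin n) : ∑ k, b l' k * b l k = if l = l' then 1 else 0 := by
      have := orthonormal_iff_ite.1 hH.eigenvectorBasis.orthonormal l l'
      simp only [PiLp.inner_apply, RCLike.inner_apply, conj_trivial] at this
      rw [← Complex.ofReal_inj] at this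
      push_cast at this
      simpa only [b, apply_ite Complex.ofReal, Complex.ofReal_one, Complex.ofReal_zero] using this
    have hsum (l : Fin n) : x * ∑ k, b l k * b i k + y * ∑ k, b l k * b j k = 0 := by
      rw [Finset.mul_sum, Finset.mul_sum, ← Finset.sum_add_distrib]
      refine Finset.sum_eq_zero fun k _ => ?_
      have hk : x * b i k + y * b j k = 0 := congrFun h k
      linear_combination b l k * hk
    have hi := hsum i
    have hj := hsum j
    simp only [hort, if_neg hij, if_neg hij.symm, if_true] at hi hj
    exact ⟨by simpa using hi, by simpa using hj⟩
  have hb_ne (i : Fin n) : b i ≠ 0 := by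
    intro h
    refine hH.eigenvectorBasis.orthonormal.ne_zero i ?_
    ext k
    exact Complex.ofReal_eq_zero.1 (congrFun h k)
  rw [hH.spectrum_real_eq_range_eigenvalues]
  constructor
  · rw [Set.ncard_range_of_injective, Nat.card_fin]
    intro i j hij
    by_contra hne
    obtain ⟨a, ha⟩ := exists_forall_eval_ne_zero hf_int hf_mono hM hm hMm ht hT
      (hH.eigenvalues i)
    have hai := ha (e (b i)) (he_deg _) (fun h => hb_ne i (he_inj _ h))
      fun k => by simpa only [he_coeff] using hb i k
    refine ha (e ((e (b j)).eval a • b i + -(e (b i)).eval a • b j)) (he_deg _) (fun h => ?_)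
      (fun k => ?_) ?_
    · exact hai (neg_eq_zero.1 (hb_lin i j hne _ _ (he_inj _ h)).2)
    · simp only [he_coeff, Pi.add_apply, Pi.smul_apply, smul_eq_mul]
      have h1 := hb i k
      have h2 := hb j k
      rw [← hij] at h2
      simp only [mul_add, Finset.sum_add_distrib, mul_left_comm (T k _ : ℂ), ← Finset.mul_sum,
        h1, h2]
      ring
    · simp only [e, map_add, map_smul, Polynomial.eval_add, Polynomial.eval_smul, smul_eq_mul]
      ring
  · rintro _ ⟨i, rfl⟩
    exact lt_and_lt_of_forall_sum_mul_coeff_eq hf_int hf_mono hM hm hMm ht hT (he_deg (b i))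
      (fun h => hb_ne i (he_inj _ h)) fun k => by simpa only [he_coeff] using hb i k
end

section
/- (Szegő's strong limit theorem, exponential form) Let b : ℤ → ℂ satisfy ∑_{k∈ℤ} |b_k| < ∞ and ∑_{k∈ℤ} |k| |b_k|² < ∞. Define f : ℝ → ℂ by f(θ) = exp( ∑_{k∈ℤ} b_k e^{ikθ} ), and let f_k = (1/2π) ∫_{−π}^{π} f(θ) e^{−ikθ} dθ be its Fourier coefficients. For n ≥ 1 let T_n(f) be the n×n Toeplitz matrix with (T_n(f))_{ij} = f_{i−j}. Then ∑_{k=1}^{∞} k b_k b_{−k} converges absolutely and lim_{n→∞} det(T_n(f)) · e^{−n b_0} = exp( ∑_{k=1}^{∞} k b_k b_{−k} ). -/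
open Real MeasureTheory

theorem Matrix.factorial_mul_det_transpose_mul {R : Type*} [CommRing R] {n N : ℕ}
    (A B : Matrix (Fin N) (Fin n) R) :
    (n.factorial : R) * (A.transpose * B).det =
      ∑ φ : Fin n → Fin N, (A.submatrix φ id).det * (B.submatrix φ id).det := by
  have expand : (A.transpose * B).det =
      ∑ φ : Fin n → Fin N, (∏ i, A (φ i) i) * (B.submatrix φ id).det := by
    have h : (A.transpose * B) = fun i => ∑ k, A k i • B k := by
      ext i j
      simp [Matrix.mul_apply, Finset.sum_apply]
    have h2 := (Matrix.detRowAlternating (n := Fin n) (R := R)).toMultilinearMap.map_sum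
      (fun (i : Fin n) (k : Fin N) => A k i • B k)
    rw [h]
    refine h2.trans (Finset.sum_congr rfl fun φ _ => ?_)
    exact (Matrix.detRowAlternating (n := Fin n) (R := R)).toMultilinearMap.map_smul_univ
      (fun i => A (φ i) i) (fun i => B (φ i))
  symm
  calc ∑ φ : Fin n → Fin N, (A.submatrix φ id).det * (B.submatrix φ id).det
      = ∑ σ : Equiv.Perm (Fin n), ∑ φ : Fin n → Fin N,
          (Equiv.Perm.sign σ : R) * (∏ i, A (φ (σ i)) i) * (B.submatrix φ id).det := by
        rw [Finset.sum_comm]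
        refine Finset.sum_congr rfl fun φ _ => ?_
        rw [Matrix.det_apply', Finset.sum_mul]
        rfl
    _ = ∑ σ : Equiv.Perm (Fin n), (A.transpose * B).det := by
        refine Finset.sum_congr rfl fun σ _ => ?_
        rw [expand, ← Equiv.sum_comp (Equiv.arrowCongr σ (Equiv.refl (Fin N)))]
        refine Finset.sum_congr rfl fun φ _ => ?_
        have h3 : (B.submatrix (Equiv.arrowCongr σ (Equiv.refl (Fin N)) φ) id).det =
            (Equiv.Perm.sign σ : R) * (B.submatrix φ id).det := by
          rw [← Equiv.Perm.sign_symm, ← Matrix.det_permute]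
          rfl
        rw [h3]
        have h4 : ((Equiv.Perm.sign σ : ℤ) : R) * ((Equiv.Perm.sign σ : ℤ) : R) = 1 := by
          rw [← Int.cast_mul, Int.units_coe_mul_self, Int.cast_one]
        simp only [Equiv.arrowCongr_apply, Equiv.coe_refl, Function.comp_apply, id,
          Equiv.symm_apply_apply]
        linear_combination (∏ i, A (φ i) i) * (B.submatrix φ id).det * h4
    _ = (n.factorial : R) * (A.transpose * B).det := by
        simp [Finset.card_univ, Fintype.card_perm]

/-- The entries of the lower triangular Toeplitz matrix with symbol `∑ c k * z ^ k`. -/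
noncomputable def toeplitzEntry (c : ℕ → ℂ) (k j : ℕ) : ℂ := if j ≤ k then c (k - j) else 0

/-- The minor on the rows `φ` and the first `n` columns. -/
noncomputable def toeplitzMinor (c : ℕ → ℂ) {n : ℕ} (φ : Fin n → ℕ) : ℂ :=
  (Matrix.of fun i j : Fin n => toeplitzEntry c (φ i) j).det

/-- The normalized vector of all `n × n` minors on the first `N` rows and first `n` columns. -/
noncomputable def minorVec (c : ℕ → ℂ) (n N : ℕ) : EuclideanSpace ℂ (Fin n → Fin N) :=
  WithLp.toLp 2 fun φ => ((√(n.factorial : ℝ))⁻¹ : ℝ) * toeplitzMinor c fun i => (φ i : ℕ)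

theorem inner_minorVec (d c : ℕ → ℂ) (n N : ℕ) :
    inner ℂ (minorVec d n N) (minorVec c n N) =
      (Matrix.of fun i j : Fin n => ∑ k ∈ Finset.range N,
        star (toeplitzEntry d k i) * toeplitzEntry c k j).det := by
  have key := Matrix.factorial_mul_det_transpose_mul
    (Matrix.of fun (k : Fin N) (i : Fin n) => star (toeplitzEntry d k i))
    (Matrix.of fun (k : Fin N) (i : Fin n) => toeplitzEntry c k i)
  have hn : (n.factorial : ℂ) ≠ 0 := by exact_mod_cast n.factorial_ne_zero
  have hmat : (Matrix.of fun i j : Fin n => ∑ k ∈ Finset.range N,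
        star (toeplitzEntry d k i) * toeplitzEntry c k j) =
      (Matrix.of fun (k : Fin N) (i : Fin n) => star (toeplitzEntry d k i)).transpose *
      (Matrix.of fun (k : Fin N) (i : Fin n) => toeplitzEntry c k i) := by
    ext i j
    simp [Matrix.mul_apply, Finset.sum_range]
  rw [hmat]
  apply mul_left_cancel₀ hn
  rw [key, PiLp.inner_apply, Finset.mul_sum]
  refine Finset.sum_congr rfl fun φ _ => ?_
  have hs : ((√(n.factorial : ℝ))⁻¹ : ℂ) * ((√(n.factorial : ℝ))⁻¹ : ℂ) * n.factorial = 1 := by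
    rw [← mul_inv, ← Complex.ofReal_mul, Real.mul_self_sqrt (Nat.cast_nonneg _)]
    push_cast
    exact inv_mul_cancel₀ hn
  have hd : ((Matrix.of fun (k : Fin N) (i : Fin n) =>
      star (toeplitzEntry d k i)).submatrix φ id).det =
      star (toeplitzMinor d fun i => (φ i : ℕ)) := by
    rw [toeplitzMinor, ← Matrix.det_conjTranspose, ← Matrix.det_transpose]
    rfl
  have hc : ((Matrix.of fun (k : Fin N) (i : Fin n) => toeplitzEntry c k i).submatrix φ id).det =
      toeplitzMinor c fun i => (φ i : ℕ) := rfl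
  rw [hd, hc]
  simp only [minorVec, RCLike.inner_apply, map_mul, map_inv₀, Complex.conj_ofReal, Complex.star_def,
    Complex.ofReal_inv]
  linear_combination (toeplitzMinor c fun i => (φ i : ℕ)) *
    (starRingEnd ℂ) (toeplitzMinor d fun i => (φ i : ℕ)) * hs

theorem toeplitzMinor_insertNth_zero {c : ℕ → ℂ} (hc : c 0 = 1) {n : ℕ} (p : Fin (n + 1))
    (φ : Fin n → ℕ) :
    toeplitzMinor c (p.insertNth 0 fun i => φ i + 1 : Fin (n + 1) → ℕ) =
      (-1) ^ (p : ℕ) * toeplitzMinor c φ := by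
  rw [toeplitzMinor, Matrix.det_succ_row _ p, Fin.sum_univ_succ]
  have h0 : ∀ j : Fin n, toeplitzEntry c 0 (j.succ : Fin (n+1)) = 0 := fun j => by
    simp [toeplitzEntry]
  have h1 : toeplitzEntry c 0 0 = 1 := by simp [toeplitzEntry, hc]
  simp only [Matrix.of_apply, Fin.insertNth_apply_same, h0, mul_zero, zero_mul,
    Finset.sum_const_zero, add_zero, Fin.val_zero, h1, mul_one]
  congr 2
  ext i j
  simp [toeplitzEntry]

theorem norm_sub_smul_minorVec_le {c d : ℕ → ℂ} (hc : c 0 = 1) (hd : d 0 = 1) (α : ℂ) (n N : ℕ) :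
    ‖minorVec c n N - α • minorVec d n N‖ ^ 2 ≤
      ‖minorVec c (n + 1) (N + 1) - α • minorVec d (n + 1) (N + 1)‖ ^ 2 := by
  have form : ∀ n N : ℕ, ‖minorVec c n N - α • minorVec d n N‖ ^ 2 = (n.factorial : ℝ)⁻¹ *
      ∑ φ : Fin n → Fin N, ‖toeplitzMinor c (fun i => (φ i : ℕ)) -
        α * toeplitzMinor d (fun i => (φ i : ℕ))‖ ^ 2 := by
    intro n N
    rw [EuclideanSpace.norm_sq_eq, Finset.mul_sum]
    refine Finset.sum_congr rfl fun φ _ => ?_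
    simp only [minorVec, PiLp.sub_apply, PiLp.smul_apply, smul_eq_mul, mul_left_comm α, ← mul_sub, norm_mul, mul_pow, Complex.norm_real,
      norm_inv, inv_pow, Real.norm_eq_abs, sq_abs]
    rw [Real.sq_sqrt (Nat.cast_nonneg _)]
  rw [form, form, Nat.factorial_succ]
  have hinj : Function.Injective (fun q : Fin (n + 1) × (Fin n → Fin N) =>
      (q.1.insertNth 0 (fun i => (q.2 i).succ) : Fin (n + 1) → Fin (N + 1))) := by
    rintro ⟨p, φ⟩ ⟨p', φ'⟩ h
    simp only at h
    have hp : p = p' := by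
      by_contra hne
      obtain ⟨i, hi⟩ := Fin.exists_succAbove_eq hne
      have := congrFun h p
      rw [Fin.insertNth_apply_same, ← hi, Fin.insertNth_apply_succAbove] at this
      exact (Fin.succ_ne_zero _ this.symm)
    subst hp
    simp only [Prod.mk.injEq, true_and]
    funext i
    have := congrFun h (p.succAbove i)
    simpa using this
  have hsum : (n + 1 : ℝ) * ∑ φ : Fin n → Fin N, ‖toeplitzMinor c (fun i => (φ i : ℕ)) -
        α * toeplitzMinor d (fun i => (φ i : ℕ))‖ ^ 2 ≤
      ∑ φ : Fin (n + 1) → Fin (N + 1), ‖toeplitzMinor c (fun i => (φ i : ℕ)) -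
        α * toeplitzMinor d (fun i => (φ i : ℕ))‖ ^ 2 := by
    calc _ = ∑ q : Fin (n + 1) × (Fin n → Fin N),
          ‖toeplitzMinor c (fun i => ((q.1.insertNth 0 (fun i => (q.2 i).succ) :
            Fin (n + 1) → Fin (N + 1)) i : ℕ)) -
          α * toeplitzMinor d (fun i => ((q.1.insertNth 0 (fun i => (q.2 i).succ) :
            Fin (n + 1) → Fin (N + 1)) i : ℕ))‖ ^ 2 := by
          rw [Fintype.sum_prod_type]
          have : ∀ (p : Fin (n + 1)) (φ : Fin n → Fin N),
            (fun i => ((p.insertNth 0 (fun i => (φ i).succ) :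
              Fin (n + 1) → Fin (N + 1)) i : ℕ)) =
            (p.insertNth 0 (fun i => (φ i : ℕ) + 1) : Fin (n + 1) → ℕ) := by
            intro p φ
            funext i
            refine Fin.succAboveCases p ?_ (fun j => ?_) i <;> simp
          simp only [this, toeplitzMinor_insertNth_zero hc, toeplitzMinor_insertNth_zero hd,
            mul_left_comm α, ← mul_sub, norm_mul, norm_pow, norm_neg, norm_one, one_pow, one_mul]
          simp
      _ ≤ _ := by
          refine (Finset.sum_map Finset.univ ⟨_, hinj⟩ (fun ψ : Fin (n + 1) → Fin (N + 1) =>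
            ‖toeplitzMinor c (fun i => (ψ i : ℕ)) - α * toeplitzMinor d (fun i => (ψ i : ℕ))‖ ^ 2)).symm.trans_le ?_
          exact Finset.sum_le_sum_of_subset_of_nonneg (Finset.subset_univ _)
            fun _ _ _ => by positivity
  have hf : (0 : ℝ) < n.factorial := by exact_mod_cast n.factorial_pos
  push_cast
  rw [mul_inv, mul_comm ((n : ℝ) + 1)⁻¹, mul_assoc]
  refine mul_le_mul_of_nonneg_left ?_ (inv_nonneg.2 hf.le)
  rw [inv_mul_eq_div, le_div_iff₀ (by positivity), mul_comm]
  exact hsum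

/-- The determinant of the Gram matrix of the first `n` columns of two lower triangular Toeplitz
matrices. -/
noncomputable def toeplitzGram (d c : ℕ → ℂ) (n : ℕ) : ℂ :=
  (Matrix.of fun i j : Fin n => ∑' k, star (toeplitzEntry d k i) * toeplitzEntry c k j).det

theorem summable_norm_toeplitzEntry {c : ℕ → ℂ} (hc : Summable fun k => ‖c k‖) (j : ℕ) :
    Summable fun k => ‖toeplitzEntry c k j‖ := by
  rw [← summable_nat_add_iff j]
  simpa [toeplitzEntry] using hc

theorem norm_toeplitzEntry_le {c : ℕ → ℂ} {M : ℝ} (hM : ∀ k, ‖c k‖ ≤ M) (k j : ℕ) :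
    ‖toeplitzEntry c k j‖ ≤ M := by
  unfold toeplitzEntry
  split_ifs
  · exact hM _
  · simpa using (norm_nonneg _).trans (hM 0)

theorem exists_norm_le_of_summable {c : ℕ → ℂ} (hc : Summable fun k => ‖c k‖) :
    ∃ M, ∀ k, ‖c k‖ ≤ M :=
  ⟨∑' k, ‖c k‖, fun k => hc.le_tsum k fun _ _ => norm_nonneg _⟩

theorem summable_star_mul_toeplitzEntry {d c : ℕ → ℂ} (hd : Summable fun k => ‖d k‖)
    (hc : Summable fun k => ‖c k‖) (i j : ℕ) :
    Summable fun k => star (toeplitzEntry d k i) * toeplitzEntry c k j := by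
  obtain ⟨M, hM⟩ := exists_norm_le_of_summable hc
  refine Summable.of_norm_bounded ((summable_norm_toeplitzEntry hd i).mul_right M) fun k => ?_
  rw [norm_mul, norm_star]
  exact mul_le_mul_of_nonneg_left (norm_toeplitzEntry_le hM k j) (norm_nonneg _)

theorem tendsto_inner_minorVec {d c : ℕ → ℂ} (hd : Summable fun k => ‖d k‖)
    (hc : Summable fun k => ‖c k‖) (n : ℕ) :
    Filter.Tendsto (fun N => inner ℂ (minorVec d n N) (minorVec c n N)) Filter.atTop
      (nhds (toeplitzGram d c n)) := by
  simp_rw [inner_minorVec]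
  refine ((continuous_id.matrix_det).tendsto _).comp ?_
  refine tendsto_pi_nhds.2 fun i => tendsto_pi_nhds.2 fun j => ?_
  exact (summable_star_mul_toeplitzEntry hd hc i j).hasSum.tendsto_sum_nat

/-- The limit of `‖minorVec c n N - α • minorVec d n N‖ ^ 2` as `N → ∞`. -/
noncomputable def gramDistSq (c d : ℕ → ℂ) (α : ℂ) (n : ℕ) : ℝ :=
  (toeplitzGram c c n).re - 2 * (α * toeplitzGram c d n).re + ‖α‖ ^ 2 * (toeplitzGram d d n).re

theorem tendsto_norm_sub_smul_minorVec {c d : ℕ → ℂ} (hc : Summable fun k => ‖c k‖)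
    (hd : Summable fun k => ‖d k‖) (α : ℂ) (n : ℕ) :
    Filter.Tendsto (fun N => ‖minorVec c n N - α • minorVec d n N‖ ^ 2) Filter.atTop
      (nhds (gramDistSq c d α n)) := by
  have h : ∀ N, ‖minorVec c n N - α • minorVec d n N‖ ^ 2 =
      (inner ℂ (minorVec c n N) (minorVec c n N)).re -
      2 * (α * inner ℂ (minorVec c n N) (minorVec d n N)).re +
      ‖α‖ ^ 2 * (inner ℂ (minorVec d n N) (minorVec d n N)).re := by
    intro N
    rw [@norm_sub_sq ℂ, inner_smul_right, norm_smul, mul_pow]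
    simp only [RCLike.re_to_complex, inner_self_eq_norm_sq_to_K]
    norm_cast
  simp_rw [h]
  exact (((Complex.continuous_re.tendsto _).comp (tendsto_inner_minorVec hc hc n)).sub
    (((Complex.continuous_re.tendsto _).comp
      ((tendsto_inner_minorVec hc hd n).const_mul α)).const_mul 2)).add
    (((Complex.continuous_re.tendsto _).comp (tendsto_inner_minorVec hd hd n)).const_mul _)

theorem gramDistSq_monotone {c d : ℕ → ℂ} (hc : Summable fun k => ‖c k‖)
    (hd : Summable fun k => ‖d k‖) (hc0 : c 0 = 1) (hd0 : d 0 = 1) (α : ℂ) :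
    Monotone (gramDistSq c d α) :=
  monotone_nat_of_le_succ fun n => le_of_tendsto_of_tendsto'
    (tendsto_norm_sub_smul_minorVec hc hd α n)
    ((tendsto_norm_sub_smul_minorVec hc hd α (n + 1)).comp (Filter.tendsto_add_atTop_nat 1))
    fun N => norm_sub_smul_minorVec_le hc0 hd0 α n N

theorem norm_toeplitzGram_sub_le {a a' c c' : ℕ → ℂ} (ha : Summable fun k => ‖a k‖)
    (ha' : Summable fun k => ‖a' k‖) (hc : Summable fun k => ‖c k‖)
    (hc' : Summable fun k => ‖c' k‖) (n : ℕ) :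
    ‖toeplitzGram a c n - toeplitzGram a' c' n‖ ≤
      √(gramDistSq a a' 1 n) * √(gramDistSq c c 0 n) +
        √(gramDistSq a' a' 0 n) * √(gramDistSq c c' 1 n) := by
  have lim : ∀ {c d : ℕ → ℂ} (_ : Summable fun k => ‖c k‖) (_ : Summable fun k => ‖d k‖) (α : ℂ),
      Filter.Tendsto (fun N => ‖minorVec c n N - α • minorVec d n N‖) Filter.atTop
      (nhds √(gramDistSq c d α n)) := by
    intro c d hc hd α
    simpa only [Function.comp_def, Real.sqrt_sq (norm_nonneg _)] using
      (Real.continuous_sqrt.tendsto _).comp (tendsto_norm_sub_smul_minorVec hc hd α n)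
  refine le_of_tendsto_of_tendsto'
    ((tendsto_inner_minorVec ha hc n).sub (tendsto_inner_minorVec ha' hc' n)).norm
    (((lim ha ha' 1).mul (lim hc hc 0)).add ((lim ha' ha' 0).mul (lim hc hc' 1))) fun N => ?_
  have h : inner ℂ (minorVec a n N) (minorVec c n N) - inner ℂ (minorVec a' n N) (minorVec c' n N) =
      inner ℂ (minorVec a n N - minorVec a' n N) (minorVec c n N) +
      inner ℂ (minorVec a' n N) (minorVec c n N - minorVec c' n N) := by
    rw [inner_sub_left, inner_sub_right]
    ring
  rw [h]
  simp only [one_smul, zero_smul, sub_zero]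
  exact (norm_add_le _ _).trans (add_le_add (norm_inner_le_norm _ _) (norm_inner_le_norm _ _))

/-- The power series coefficients of `∏ i < m, (1 - x i * z)⁻¹`. -/
noncomputable def geomProdCoeff (x : ℕ → ℂ) (m k : ℕ) : ℂ :=
  PowerSeries.coeff k (∏ i ∈ Finset.range m, PowerSeries.mk fun k => x i ^ k)

theorem geomProdCoeff_succ (x : ℕ → ℂ) (m k : ℕ) :
    geomProdCoeff x (m + 1) k =
      ∑ p ∈ Finset.HasAntidiagonal.antidiagonal k, geomProdCoeff x m p.1 * x m ^ p.2 := by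
  simp [geomProdCoeff, Finset.prod_range_succ, PowerSeries.coeff_mul]

theorem geomProdCoeff_zero (x : ℕ → ℂ) (m : ℕ) : geomProdCoeff x m 0 = 1 := by
  induction m with
  | zero => simp [geomProdCoeff]
  | succ m ih => simp [geomProdCoeff_succ, ih]

theorem geomProdCoeff_eq_of_le {x : ℕ → ℂ} {m n : ℕ} (hx : ∀ i, m ≤ i → x i = 0) (h : m ≤ n) :
    geomProdCoeff x n = geomProdCoeff x m := by
  induction n, h using Nat.le_induction with
  | base => rfl
  | succ n hn ih =>
    rw [← ih]
    have : (PowerSeries.mk fun k => x n ^ k) = 1 := by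
      ext k
      simp [hx n hn, PowerSeries.coeff_one, zero_pow_eq]
    funext k
    simp [geomProdCoeff, Finset.prod_range_succ, this]

theorem summable_norm_geomProdCoeff {x : ℕ → ℂ} (hx : ∀ i, ‖x i‖ < 1) (m : ℕ) :
    Summable fun k => ‖geomProdCoeff x m k‖ := by
  induction m with
  | zero =>
    refine summable_of_ne_finset_zero (s := {0}) fun k hk => ?_
    simp [geomProdCoeff, PowerSeries.coeff_one, Finset.notMem_singleton.1 hk]
  | succ m ih =>
    simp_rw [geomProdCoeff_succ]
    exact summable_norm_sum_mul_antidiagonal_of_summable_norm ih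
      (by simpa using summable_geometric_of_lt_one (norm_nonneg _) (hx m))

theorem summable_norm_mul_pow {c : ℕ → ℂ} (hc : Summable fun k => ‖c k‖) {z : ℂ} (hz : ‖z‖ ≤ 1) :
    Summable fun k => ‖c k * z ^ k‖ := by
  refine Summable.of_nonneg_of_le (fun _ => norm_nonneg _) (fun k => ?_) hc
  rw [norm_mul, norm_pow]
  exact mul_le_of_le_one_right (norm_nonneg _) (pow_le_one₀ (norm_nonneg _) hz)

theorem norm_mul_lt_one {x z : ℂ} (hx : ‖x‖ < 1) (hz : ‖z‖ ≤ 1) : ‖x * z‖ < 1 := by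
  rw [norm_mul]
  exact (mul_le_of_le_one_right (norm_nonneg _) hz).trans_lt hx

theorem tsum_geomProdCoeff_mul_pow {x : ℕ → ℂ} (hx : ∀ i, ‖x i‖ < 1) (m : ℕ) {z : ℂ}
    (hz : ‖z‖ ≤ 1) :
    ∑' k, geomProdCoeff x m k * z ^ k = ∏ i ∈ Finset.range m, (1 - x i * z)⁻¹ := by
  induction m with
  | zero =>
    rw [tsum_eq_single 0 fun k hk => by simp [geomProdCoeff, PowerSeries.coeff_one, hk]]
    simp [geomProdCoeff]
  | succ m ih =>
    have hgeom : Summable fun k => ‖(x m * z) ^ k‖ := by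
      simpa using summable_geometric_of_lt_one (norm_nonneg _) (norm_mul_lt_one (hx m) hz)
    rw [Finset.prod_range_succ, ← ih, ← tsum_geometric_of_norm_lt_one (norm_mul_lt_one (hx m) hz),
      tsum_mul_tsum_eq_tsum_sum_antidiagonal_of_summable_norm
        (summable_norm_mul_pow (summable_norm_geomProdCoeff hx m) hz) hgeom]
    refine tsum_congr fun k => ?_
    rw [geomProdCoeff_succ, Finset.sum_mul]
    refine Finset.sum_congr rfl fun p hp => ?_
    rw [← Finset.HasAntidiagonal.mem_antidiagonal.1 hp, pow_add, mul_pow]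
    ring

theorem norm_geomProdCoeff_le {x y : ℕ → ℂ} (h : ∀ i, ‖x i‖ ≤ ‖y i‖) (hy : ∀ i, y i = ‖y i‖)
    (m k : ℕ) : ‖geomProdCoeff x m k‖ ≤ ‖geomProdCoeff y m k‖ := by
  suffices H : ∀ m k, ((‖geomProdCoeff y m k‖ : ℝ) : ℂ) = geomProdCoeff y m k ∧
      ‖geomProdCoeff x m k‖ ≤ ‖geomProdCoeff y m k‖ from (H m k).2
  intro m
  induction m with
  | zero => intro k; by_cases hk : k = 0 <;> simp [geomProdCoeff, PowerSeries.coeff_one, hk]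
  | succ m ih =>
    intro k
    have e : geomProdCoeff y (m + 1) k =
        ((∑ p ∈ Finset.HasAntidiagonal.antidiagonal k, ‖geomProdCoeff y m p.1‖ * ‖y m‖ ^ p.2 : ℝ) : ℂ) := by
      rw [geomProdCoeff_succ]
      push_cast
      refine Finset.sum_congr rfl fun p _ => ?_
      rw [(ih p.1).1, ← hy m]
    have e' : ‖geomProdCoeff y (m + 1) k‖ =
        ∑ p ∈ Finset.HasAntidiagonal.antidiagonal k, ‖geomProdCoeff y m p.1‖ * ‖y m‖ ^ p.2 := by
      rw [e, Complex.norm_real, Real.norm_of_nonneg (by positivity)]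
    refine ⟨by rw [e', ← e], ?_⟩
    rw [e', geomProdCoeff_succ]
    refine (norm_sum_le _ _).trans (Finset.sum_le_sum fun p _ => ?_)
    rw [norm_mul, norm_pow]
    exact mul_le_mul (ih p.1).2 (pow_le_pow_left₀ (norm_nonneg _) (h m) _) (by positivity)
      (norm_nonneg _)

theorem coeff_prod_one_sub_eq_zero {ι : Type*} [DecidableEq ι] (x : ι → ℂ) (s : Finset ι) :
    ∀ k, s.card < k →
      PowerSeries.coeff k (∏ i ∈ s, (1 - PowerSeries.C (x i) * PowerSeries.X)) = 0 := by
  induction s using Finset.induction_on with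
  | empty => intro k hk; simpa [PowerSeries.coeff_one] using (Nat.pos_iff_ne_zero.1 hk)
  | insert a s ha ih =>
    intro k hk
    rw [Finset.card_insert_of_notMem ha] at hk
    obtain ⟨k, rfl⟩ : ∃ l, k = l + 1 := ⟨k - 1, by omega⟩
    rw [Finset.prod_insert ha, sub_mul, one_mul, mul_assoc, map_sub, PowerSeries.coeff_C_mul,
      PowerSeries.coeff_succ_X_mul, ih _ (by omega), ih _ (by omega)]
    simp

theorem mk_pow_mul_one_sub (x : ℂ) :
    (PowerSeries.mk fun k => x ^ k) * (1 - PowerSeries.C x * PowerSeries.X) = 1 := by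
  ext k
  rw [mul_sub, mul_one, ← mul_assoc, map_sub]
  cases k with
  | zero => simp
  | succ k => simp [PowerSeries.coeff_succ_mul_X, PowerSeries.coeff_one, pow_succ]

theorem exists_toeplitzEntry_geomProdCoeff_eq {x : ℕ → ℂ} {n : ℕ}
    (hx : Function.Injective fun i : Fin n => x i) :
    ∃ C : Matrix (Fin n) (Fin n) ℂ, ∀ (k : ℕ) (j : Fin n),
      toeplitzEntry (geomProdCoeff x n) k j = ∑ l : Fin n, x l ^ k * C l j := by
  set V : Matrix (Fin n) (Fin n) ℂ := (Matrix.vandermonde fun i : Fin n => x i).transpose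
  have hV : IsUnit V.det := by
    rw [Matrix.det_transpose, isUnit_iff_ne_zero, Matrix.det_vandermonde_ne_zero_iff]
    exact hx
  set T : Matrix (Fin n) (Fin n) ℂ :=
    Matrix.of fun k j => toeplitzEntry (geomProdCoeff x n) k j
  refine ⟨V⁻¹ * T, fun k j => ?_⟩
  set C := V⁻¹ * T with hC
  have hVC : V * C = T := by rw [hC, Matrix.mul_nonsing_inv_cancel_left _ _ hV]
  set P : PowerSeries ℂ := ∏ i ∈ Finset.range n, PowerSeries.mk fun k => x i ^ k with hP
  set Q : PowerSeries ℂ := ∏ i ∈ Finset.range n, (1 - PowerSeries.C (x i) * PowerSeries.X) with hQ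
  have hPQ : P * Q = 1 := by
    rw [hP, hQ, ← Finset.prod_mul_distrib]
    exact Finset.prod_eq_one fun i _ => mk_pow_mul_one_sub _
  set S : PowerSeries ℂ := PowerSeries.X ^ (j : ℕ) * P -
    ∑ l : Fin n, PowerSeries.C (C l j) * PowerSeries.mk fun k => x l ^ k with hS
  have hcoeff : ∀ k, PowerSeries.coeff k S =
      toeplitzEntry (geomProdCoeff x n) k j - ∑ l : Fin n, x l ^ k * C l j := by
    intro k
    rw [hS, map_sub, PowerSeries.coeff_X_pow_mul', map_sum]
    simp [toeplitzEntry, geomProdCoeff, hP, mul_comm]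
  have hsmall : ∀ k < n, PowerSeries.coeff k S = 0 := by
    intro k hk
    rw [hcoeff, sub_eq_zero]
    have := congrFun (congrFun hVC ⟨k, hk⟩) j
    rw [Matrix.mul_apply] at this
    exact this.symm
  have hSQ : S * Q = 0 := by
    ext k
    rw [map_zero]
    rcases lt_or_ge k n with hk | hk
    · rw [PowerSeries.coeff_mul]
      refine Finset.sum_eq_zero fun p hp => ?_
      rw [hsmall p.1 ((Finset.HasAntidiagonal.antidiagonal.fst_le hp).trans_lt hk), zero_mul]
    · have hl : ∀ l : Fin n, (PowerSeries.mk fun k => x l ^ k) * Q =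
          ∏ i ∈ (Finset.range n).erase l, (1 - PowerSeries.C (x i) * PowerSeries.X) := by
        intro l
        rw [hQ, ← Finset.mul_prod_erase _ _ (Finset.mem_range.2 l.2), ← mul_assoc,
          mk_pow_mul_one_sub, one_mul]
      rw [hS, sub_mul, mul_assoc, hPQ, mul_one, Finset.sum_mul, map_sub, map_sum,
        PowerSeries.coeff_X_pow, if_neg (by omega), zero_sub, neg_eq_zero]
      refine Finset.sum_eq_zero fun l _ => ?_
      rw [mul_assoc, hl, PowerSeries.coeff_C_mul, coeff_prod_one_sub_eq_zero, mul_zero]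
      rw [Finset.card_erase_of_mem (Finset.mem_range.2 l.2), Finset.card_range]
      have := l.2
      omega
  have hS0 : S = 0 := by
    calc S = S * Q * P := by rw [mul_assoc, mul_comm Q, hPQ, mul_one]
      _ = 0 := by rw [hSQ, zero_mul]
  have := hcoeff k
  rw [hS0, map_zero] at this
  exact (sub_eq_zero.1 this.symm)

theorem det_toeplitzEntry {c : ℕ → ℂ} (hc : c 0 = 1) (n : ℕ) :
    (Matrix.of fun i j : Fin n => toeplitzEntry c i j).det = 1 := by
  rw [Matrix.det_of_isLowerTriangular]
  · simp [toeplitzEntry, hc]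
  · intro i j hij
    have : (i : ℕ) < j := hij
    simp [toeplitzEntry, this.not_ge, -Fin.val_fin_le]

theorem tsum_star_toeplitzEntry_mul_pow {d : ℕ → ℂ} (hd : Summable fun k => ‖d k‖) {z : ℂ}
    (hz : ‖z‖ ≤ 1) (i : ℕ) :
    HasSum (fun k => star (toeplitzEntry d k i) * z ^ k) (z ^ i * star (∑' k, d k * star z ^ k)) := by
  rw [← hasSum_nat_add_iff' i]
  have h0 : ∑ k ∈ Finset.range i, star (toeplitzEntry d k i) * z ^ k = 0 :=
    Finset.sum_eq_zero fun k hk => by simp [toeplitzEntry, Finset.mem_range.1 hk]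
  rw [h0, sub_zero]
  have h1 : HasSum (fun k => d k * star z ^ k) (∑' k, d k * star z ^ k) :=
    (summable_norm_mul_pow hd (by simpa using hz)).of_norm.hasSum
  have h2 : ∀ k, star (toeplitzEntry d (k + i) i) * z ^ (k + i) =
      z ^ i * star (d k * star z ^ k) := fun k => by
    simp [toeplitzEntry, pow_add]
    ring
  simp_rw [h2]
  exact h1.star.mul_left (z ^ i)

theorem toeplitzGram_geomProdCoeff_of_injective {d : ℕ → ℂ} (hd : Summable fun k => ‖d k‖)
    {x : ℕ → ℂ} (hx : ∀ i, ‖x i‖ < 1) {n : ℕ} (hinj : Function.Injective fun i : Fin n => x i) :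
    toeplitzGram d (geomProdCoeff x n) n =
      ∏ l ∈ Finset.range n, star (∑' k, d k * star (x l) ^ k) := by
  obtain ⟨C, hC⟩ := exists_toeplitzEntry_geomProdCoeff_eq hinj
  set V : Matrix (Fin n) (Fin n) ℂ := (Matrix.vandermonde fun i : Fin n => x i).transpose with hV
  set g : Fin n → ℂ := fun l => star (∑' k, d k * star (x l) ^ k) with hg
  have h1 : V * C = Matrix.of fun i j : Fin n => toeplitzEntry (geomProdCoeff x n) i j := by
    ext i j
    simp [hV, Matrix.mul_apply, hC, Matrix.vandermonde_apply]
  have h2 : (Matrix.of fun i j : Fin n => ∑' k, star (toeplitzEntry d k i) *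
      toeplitzEntry (geomProdCoeff x n) k j) = V * Matrix.diagonal g * C := by
    ext i j
    rw [Matrix.mul_apply]
    simp only [Matrix.of_apply, Matrix.mul_diagonal, hC]
    have : HasSum (fun k => ∑ l : Fin n, star (toeplitzEntry d k i) * x l ^ k * C l j)
        (∑ l : Fin n, x l ^ (i : ℕ) * star (∑' k, d k * star (x l) ^ k) * C l j) :=
      hasSum_sum fun l _ => (tsum_star_toeplitzEntry_mul_pow hd (hx l).le i).mul_right _
    simp only [Finset.mul_sum, ← mul_assoc]
    rw [this.tsum_eq]
    rfl
  have h3 : V.det * C.det = 1 := by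
    rw [← Matrix.det_mul, h1, det_toeplitzEntry (geomProdCoeff_zero x n)]
  rw [toeplitzGram, h2, Matrix.det_mul, Matrix.det_mul, Matrix.det_diagonal, mul_right_comm, h3,
    one_mul, Finset.prod_range]

theorem toeplitzGram_geomProdCoeff {d : ℕ → ℂ} (hd : Summable fun k => ‖d k‖)
    {x : ℕ → ℂ} {r : ℝ} (hr : r < 1) (hx : ∀ i, ‖x i‖ < r) (n : ℕ) :
    toeplitzGram d (geomProdCoeff x n) n =
      ∏ l ∈ Finset.range n, star (∑' k, d k * star (x l) ^ k) := by
  have hr0 : 0 ≤ r := (norm_nonneg _).trans (hx 0).le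
  -- Perturb `x` to make its first `n` entries distinct; cut off to keep the bound elsewhere.
  set y : ℂ → ℕ → ℂ := fun t i => if i < n then x i + t * i else 0 with hy
  have hy0 : geomProdCoeff (y 0) n = geomProdCoeff x n := by
    funext k
    unfold geomProdCoeff
    congr 1
    refine Finset.prod_congr rfl fun i hi => ?_
    simp [hy, Finset.mem_range.1 hi]
  have hycont : ∀ i, Continuous fun t => y t i := by
    intro i
    by_cases hi : i < n <;> simp only [hy, hi, if_true, if_false] <;> fun_prop
  have hyle : ∀ᶠ t in nhds (0 : ℂ), ∀ i, ‖y t i‖ ≤ r := by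
    have : ∀ᶠ t in nhds (0 : ℂ), ∀ i ∈ Finset.range n, ‖y t i‖ < r := by
      rw [Filter.eventually_all_finset]
      intro i hi
      have h := (hycont i).norm.tendsto 0
      refine h.eventually_lt_const ?_
      simpa [hy, Finset.mem_range.1 hi] using hx i
    filter_upwards [this] with t ht i
    by_cases hi : i < n
    · exact (ht i (Finset.mem_range.2 hi)).le
    · simpa [hy, hi] using hr0
  have hyinj : ∀ᶠ t in nhdsWithin (0 : ℂ) {0}ᶜ, Function.Injective fun i : Fin n => y t i := by
    have : ∀ᶠ t in nhdsWithin (0 : ℂ) {0}ᶜ, ∀ i j : Fin n, i ≠ j → y t i ≠ y t j := by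
      rw [Filter.eventually_all]
      intro i
      rw [Filter.eventually_all]
      intro j
      by_cases hij : i = j
      · exact Filter.Eventually.of_forall fun _ h => (h hij).elim
      have hne : ((j : ℕ) : ℂ) - ((i : ℕ) : ℂ) ≠ 0 := by
        rw [sub_ne_zero]
        exact_mod_cast fun h => hij (Fin.ext h).symm
      have hfin : ∀ᶠ t in nhdsWithin (0 : ℂ) {0}ᶜ,
          t ≠ (x i - x j) / (((j : ℕ) : ℂ) - ((i : ℕ) : ℂ)) := by
        by_cases h0 : (x i - x j) / (((j : ℕ) : ℂ) - ((i : ℕ) : ℂ)) = 0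
        · rw [h0]
          exact eventually_mem_nhdsWithin
        · exact (nhdsWithin_le_nhds) (isOpen_ne.mem_nhds (Ne.symm h0))
      filter_upwards [hfin] with t ht _ h
      apply ht
      simp only [hy, i.2, j.2, if_true] at h
      rw [eq_div_iff hne]
      linear_combination -h
    filter_upwards [this] with t ht i j h
    by_contra hij
    exact ht i j hij h
  have hbound : ∃ M, ∀ᶠ t in nhds (0 : ℂ), ∀ k, ‖geomProdCoeff (y t) n k‖ ≤ M := by
    obtain ⟨M, hM⟩ := exists_norm_le_of_summable
      (summable_norm_geomProdCoeff (x := fun _ => (r : ℂ)) (by simpa [abs_of_nonneg hr0] using hr) n)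
    refine ⟨M, ?_⟩
    filter_upwards [hyle] with t ht k
    refine (norm_geomProdCoeff_le (y := fun _ => (r : ℂ)) (fun i => ?_) (fun i => ?_) n k).trans
      (hM k)
    · simpa [abs_of_nonneg hr0] using ht i
    · simp [abs_of_nonneg hr0]
  obtain ⟨M, hM⟩ := hbound
  have hcoeffcont : ∀ m k, Continuous fun t => geomProdCoeff (y t) m k := by
    intro m
    induction m with
    | zero => intro k; simp only [geomProdCoeff, Finset.range_zero, Finset.prod_empty]; fun_prop
    | succ m ih =>
      intro k
      simp_rw [geomProdCoeff_succ]
      exact continuous_finsetSum _ fun p _ => (ih p.1).mul ((hycont m).pow _)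
  have lhs : Filter.Tendsto (fun t => toeplitzGram d (geomProdCoeff (y t) n) n) (nhds 0)
      (nhds (toeplitzGram d (geomProdCoeff (y 0) n) n)) := by
    refine ((continuous_id.matrix_det).tendsto _).comp ?_
    refine tendsto_pi_nhds.2 fun i => tendsto_pi_nhds.2 fun j => ?_
    refine tendsto_tsum_of_dominated_convergence
      ((summable_norm_toeplitzEntry hd i).mul_right M) (fun k => ?_) ?_
    · refine Filter.Tendsto.const_mul _ (Continuous.tendsto ?_ 0)
      unfold toeplitzEntry
      split_ifs
      · exact hcoeffcont _ _
      · exact continuous_const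
    · filter_upwards [hM] with t ht k
      rw [norm_mul, norm_star]
      exact mul_le_mul_of_nonneg_left (norm_toeplitzEntry_le ht k j) (norm_nonneg _)
  have rhs : Filter.Tendsto
      (fun t => ∏ l ∈ Finset.range n, star (∑' k, d k * star (y t l) ^ k)) (nhds 0)
      (nhds (∏ l ∈ Finset.range n, star (∑' k, d k * star (y 0 l) ^ k))) := by
    refine tendsto_finsetProd _ fun l _ => (continuous_star.tendsto _).comp ?_
    refine tendsto_tsum_of_dominated_convergence hd (fun k => ?_) ?_
    · exact Continuous.tendsto (continuous_const.mul ((hycont l).star.pow k)) 0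
    · filter_upwards [hyle] with t ht k
      rw [norm_mul, norm_pow, norm_star]
      exact mul_le_of_le_one_right (norm_nonneg _)
        (pow_le_one₀ (norm_nonneg _) ((ht l).trans hr.le))
  have heq := tendsto_nhds_unique_of_eventuallyEq (lhs.mono_left nhdsWithin_le_nhds)
    (rhs.mono_left nhdsWithin_le_nhds) (by
      filter_upwards [hyinj, nhdsWithin_le_nhds hyle] with t ht ht'
      exact toeplitzGram_geomProdCoeff_of_injective hd (fun i => (ht' i).trans_lt hr) ht)
  rw [hy0] at heq
  rw [heq]
  refine Finset.prod_congr rfl fun l hl => ?_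
  simp [hy, Finset.mem_range.1 hl]

/-- The coefficients of `-∑ i < m, log (1 - x i * z)`. -/
noncomputable def logCoeff (x : ℕ → ℂ) (m k : ℕ) : ℂ := (∑ i ∈ Finset.range m, x i ^ k) / k

/-- A finite family of points, padded with zeros, in a disc of radius less than one. -/
structure IsNodes (x : ℕ → ℂ) (m : ℕ) : Prop where
  eq_zero : ∀ i, m ≤ i → x i = 0
  exists_radius : ∃ r < 1, ∀ i, ‖x i‖ < r

theorem IsNodes.norm_lt_one {x : ℕ → ℂ} {m : ℕ} (h : IsNodes x m) (i : ℕ) : ‖x i‖ < 1 := by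
  obtain ⟨r, hr, hx⟩ := h.exists_radius
  exact (hx i).trans hr

theorem logCoeff_zero (x : ℕ → ℂ) (m : ℕ) : logCoeff x m 0 = 0 := by simp [logCoeff]

theorem natCast_mul_logCoeff (x : ℕ → ℂ) (m : ℕ) {k : ℕ} (hk : k ≠ 0) :
    (k : ℂ) * logCoeff x m k = ∑ i ∈ Finset.range m, x i ^ k := by
  rw [logCoeff, mul_div_cancel₀ _ (by exact_mod_cast hk)]

theorem IsNodes.logCoeff_eq {x : ℕ → ℂ} {m n : ℕ} (h : IsNodes x m) (hmn : m ≤ n) :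
    logCoeff x n = logCoeff x m := by
  funext k
  rcases eq_or_ne k 0 with rfl | hk
  · simp [logCoeff_zero]
  · unfold logCoeff
    congr 1
    symm
    refine Finset.sum_subset (Finset.range_subset_range.2 hmn) fun i _ hi => ?_
    rw [h.eq_zero i (by simpa using hi), zero_pow hk]

theorem hasSum_logCoeff_mul_pow {x : ℕ → ℂ} (hx : ∀ i, ‖x i‖ < 1) (m : ℕ) {z : ℂ}
    (hz : ‖z‖ ≤ 1) : HasSum (fun k => logCoeff x m k * z ^ k)
      (∑ i ∈ Finset.range m, -Complex.log (1 - x i * z)) := by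
  have := hasSum_sum (s := Finset.range m) fun i _ =>
    Complex.hasSum_taylorSeries_neg_log (norm_mul_lt_one (hx i) hz)
  convert this using 2 with k
  rw [logCoeff, Finset.sum_div, Finset.sum_mul]
  refine Finset.sum_congr rfl fun i _ => ?_
  rw [mul_pow]
  ring

theorem exp_tsum_logCoeff {x : ℕ → ℂ} (hx : ∀ i, ‖x i‖ < 1) (m : ℕ) {z : ℂ}
    (hz : ‖z‖ ≤ 1) : Complex.exp (∑' k, logCoeff x m k * z ^ k) =
      ∏ i ∈ Finset.range m, (1 - x i * z)⁻¹ := by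
  rw [(hasSum_logCoeff_mul_pow hx m hz).tsum_eq, Complex.exp_sum]
  refine Finset.prod_congr rfl fun i _ => ?_
  rw [Complex.exp_neg, Complex.exp_log]
  intro h
  have h1 := norm_mul_lt_one (hx i) hz
  rw [← sub_eq_zero.1 h, norm_one] at h1
  exact lt_irrefl _ h1

theorem toeplitzGram_eq_exp {x y : ℕ → ℂ} {m m' n : ℕ} (hx : IsNodes x m) (hy : IsNodes y m')
    (hm : m ≤ n) :
    toeplitzGram (geomProdCoeff y m') (geomProdCoeff x m) n =
      Complex.exp (∑' k : ℕ, k * star (logCoeff y m' k) * logCoeff x m k) := by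
  obtain ⟨r, hr, hxr⟩ := hx.exists_radius
  rw [← geomProdCoeff_eq_of_le hx.eq_zero hm,
    toeplitzGram_geomProdCoeff (summable_norm_geomProdCoeff hy.norm_lt_one m') hr hxr,
    ← hx.logCoeff_eq hm]
  have h1 : ∀ l, HasSum (fun k => star (logCoeff y m' k) * x l ^ k)
      (star (∑' k, logCoeff y m' k * star (x l) ^ k)) := by
    intro l
    have := (hasSum_logCoeff_mul_pow hy.norm_lt_one m' (z := star (x l))
      (by simpa using (hx.norm_lt_one l).le)).summable.hasSum.star
    have h2 : ∀ k, star (logCoeff y m' k * star (x l) ^ k) =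
        star (logCoeff y m' k) * x l ^ k := fun k => by simp
    simpa only [h2] using this
  have h3 : ∀ k : ℕ, k * star (logCoeff y m' k) * logCoeff x n k =
      ∑ l ∈ Finset.range n, star (logCoeff y m' k) * x l ^ k := by
    intro k
    rcases eq_or_ne k 0 with rfl | hk
    · simp [logCoeff_zero]
    · rw [mul_right_comm, natCast_mul_logCoeff _ _ hk, Finset.sum_mul]
      exact Finset.sum_congr rfl fun l _ => mul_comm _ _
  simp_rw [h3]
  rw [(hasSum_sum fun l _ => h1 l).tsum_eq, Complex.exp_sum]
  refine Finset.prod_congr rfl fun l _ => ?_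
  have hl : ‖star (x l)‖ ≤ 1 := by simpa using (hx.norm_lt_one l).le
  rw [tsum_geomProdCoeff_mul_pow hy.norm_lt_one m' hl, ← exp_tsum_logCoeff hy.norm_lt_one m' hl]
  exact (Complex.exp_conj _).symm

theorem summable_natCast_mul_norm_logCoeff {x : ℕ → ℂ} (hx : ∀ i, ‖x i‖ < 1) (m : ℕ) :
    Summable fun k : ℕ => (k : ℝ) * ‖logCoeff x m k‖ := by
  refine Summable.of_nonneg_of_le (fun k => by positivity) (fun k => ?_)
    (summable_sum (s := Finset.range m) fun i _ =>
      summable_geometric_of_lt_one (norm_nonneg (x i)) (hx i))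
  rcases eq_or_ne k 0 with rfl | hk
  · simp
  · have : (k : ℝ) * ‖logCoeff x m k‖ = ‖(k : ℂ) * logCoeff x m k‖ := by simp
    rw [this, natCast_mul_logCoeff x m hk]
    exact (norm_sum_le _ _).trans_eq (by simp)

theorem norm_le_natCast_mul_norm {δ : ℕ → ℂ} (h0 : δ 0 = 0) (k : ℕ) :
    ‖δ k‖ ≤ (k : ℝ) * ‖δ k‖ := by
  rcases eq_or_ne k 0 with rfl | hk
  · simp [h0]
  · exact le_mul_of_one_le_left (norm_nonneg _) (by exact_mod_cast Nat.one_le_iff_ne_zero.2 hk)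

theorem summable_norm_of_natCast_mul {δ : ℕ → ℂ} (h0 : δ 0 = 0)
    (h : Summable fun k : ℕ => (k : ℝ) * ‖δ k‖) : Summable fun k => ‖δ k‖ :=
  Summable.of_nonneg_of_le (fun _ => norm_nonneg _) (norm_le_natCast_mul_norm h0) h

theorem natCast_mul_norm_sq_le {δ : ℕ → ℂ} (h0 : δ 0 = 0)
    (h : Summable fun k : ℕ => (k : ℝ) * ‖δ k‖) (k : ℕ) :
    (k : ℝ) * ‖δ k‖ ^ 2 ≤ (∑' j : ℕ, (j : ℝ) * ‖δ j‖) * ((k : ℝ) * ‖δ k‖) := by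
  have h1 := (norm_le_natCast_mul_norm h0 k).trans (h.le_tsum k fun _ _ => by positivity)
  calc (k : ℝ) * ‖δ k‖ ^ 2 = ‖δ k‖ * ((k : ℝ) * ‖δ k‖) := by ring
    _ ≤ _ := mul_le_mul_of_nonneg_right h1 (by positivity)

theorem summable_natCast_mul_norm_sq {δ : ℕ → ℂ} (h0 : δ 0 = 0)
    (h : Summable fun k : ℕ => (k : ℝ) * ‖δ k‖) : Summable fun k : ℕ => (k : ℝ) * ‖δ k‖ ^ 2 :=
  Summable.of_nonneg_of_le (fun _ => by positivity) (natCast_mul_norm_sq_le h0 h) (h.mul_left _)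

/-- The sequence `b` is approximated by sequences of the form `logCoeff x m`. -/
def IsLogApprox (b : ℕ → ℂ) : Prop :=
  ∀ ε > 0, ∃ x m, IsNodes x m ∧ (Summable fun k : ℕ => (k : ℝ) * ‖logCoeff x m k - b k‖) ∧
    ∑' k : ℕ, (k : ℝ) * ‖logCoeff x m k - b k‖ < ε

theorem IsLogApprox.zero : IsLogApprox 0 := fun ε hε =>
  ⟨0, 0, ⟨fun _ _ => rfl, ⟨1 / 2, by norm_num, by simp⟩⟩, by simp [logCoeff], by simpa [logCoeff]⟩

theorem IsLogApprox.add {b b' : ℕ → ℂ} (h : IsLogApprox b) (h' : IsLogApprox b') :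
    IsLogApprox (b + b') := by
  intro ε hε
  obtain ⟨x, m, hx, hs, hlt⟩ := h (ε / 2) (half_pos hε)
  obtain ⟨y, m', hy, hs', hlt'⟩ := h' (ε / 2) (half_pos hε)
  set w : ℕ → ℂ := fun i => if i < m then x i else y (i - m) with hw
  have hlog : ∀ k, logCoeff w (m + m') k = logCoeff x m k + logCoeff y m' k := by
    intro k
    rw [logCoeff, logCoeff, logCoeff, Finset.sum_range_add, add_div]
    congr 2
    · exact Finset.sum_congr rfl fun i hi => by simp [hw, Finset.mem_range.1 hi]
    · exact Finset.sum_congr rfl fun i hi => by simp [hw]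
  have hle : ∀ k : ℕ, (k : ℝ) * ‖logCoeff w (m + m') k - (b + b') k‖ ≤
      k * ‖logCoeff x m k - b k‖ + k * ‖logCoeff y m' k - b' k‖ := by
    intro k
    rw [← mul_add, hlog, Pi.add_apply, add_sub_add_comm]
    exact mul_le_mul_of_nonneg_left (norm_add_le _ _) (Nat.cast_nonneg _)
  have hsum := Summable.of_nonneg_of_le (fun k => by positivity) hle (hs.add hs')
  refine ⟨w, m + m', ⟨fun i hi => ?_, ?_⟩, hsum, ?_⟩
  · have : ¬ i < m := by omega
    simp only [hw, this, if_false]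
    exact hy.eq_zero _ (by omega)
  · obtain ⟨r, hr, hxr⟩ := hx.exists_radius
    obtain ⟨r', hr', hyr⟩ := hy.exists_radius
    refine ⟨max r r', max_lt hr hr', fun i => ?_⟩
    simp only [hw]
    split_ifs
    · exact (hxr _).trans_le (le_max_left _ _)
    · exact (hyr _).trans_le (le_max_right _ _)
  · refine (hsum.tsum_le_tsum hle (hs.add hs')).trans_lt ?_
    rw [hs.tsum_add hs']
    linarith

theorem IsLogApprox.single {l : ℕ} (hl : l ≠ 0) (a : ℂ) : IsLogApprox (Pi.single l a) := by
  intro ε hε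
  set s : ℕ → ℂ := Pi.single l a with hs
  have hlim : Filter.Tendsto (fun N : ℕ => (l : ℝ) * ‖a‖ * (‖a‖ / N) * (1 - ‖a‖ / N)⁻¹)
      Filter.atTop (nhds 0) := by
    have h := tendsto_const_div_atTop_nhds_zero_nat ‖a‖
    have := (h.const_mul ((l : ℝ) * ‖a‖)).mul ((h.const_sub 1).inv₀ (by norm_num))
    simpa using this
  obtain ⟨N, hN, hN1, hN0⟩ := ((hlim.eventually_lt_const hε).and
    (((tendsto_const_div_atTop_nhds_zero_nat ‖a‖).eventually_lt_const one_pos).and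
      (Filter.eventually_gt_atTop 0))).exists
  have hNC : (N : ℂ) ≠ 0 := by exact_mod_cast hN0.ne'
  obtain ⟨w, hw⟩ := IsAlgClosed.exists_pow_nat_eq (a / N) (Nat.pos_of_ne_zero hl)
  have hwnorm : ‖w‖ ^ l = ‖a‖ / N := by rw [← norm_pow, hw]; simp
  have hw1 : ‖w‖ < 1 := by
    by_contra! h
    exact absurd (one_le_pow₀ h (n := l)) (by rw [hwnorm]; exact not_le.2 hN1)
  set ζ : ℂ := Complex.exp (2 * π * Complex.I / l)
  have hζ : IsPrimitiveRoot ζ l := Complex.isPrimitiveRoot_exp l hl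
  have hζn : ‖ζ‖ = 1 := hζ.norm'_eq_one hl
  set x : ℕ → ℂ := fun i => if i < N * l then w * ζ ^ i else 0 with hx
  have hsum : ∀ k, ∑ i ∈ Finset.range (N * l), x i ^ k = if l ∣ k then N * l * w ^ k else 0 := by
    intro k
    have h1 : ∑ i ∈ Finset.range (N * l), x i ^ k =
        w ^ k * ∑ i ∈ Finset.range (N * l), (ζ ^ k) ^ i := by
      rw [Finset.mul_sum]
      refine Finset.sum_congr rfl fun i hi => ?_
      simp only [hx, Finset.mem_range.1 hi, if_true, mul_pow]
      ring
    rw [h1]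
    split_ifs with hk
    · rw [(hζ.pow_eq_one_iff_dvd k).2 hk]
      simp
      ring
    · have h2 : ζ ^ k - 1 ≠ 0 := sub_ne_zero.2 fun h => hk ((hζ.pow_eq_one_iff_dvd k).1 h)
      have h3 := geom_sum_mul (ζ ^ k) (N * l)
      have h4 : (ζ ^ k) ^ (N * l) = 1 := by
        rw [← pow_mul, show k * (N * l) = l * (k * N) by ring, pow_mul, hζ.pow_eq_one, one_pow]
      rw [h4, sub_self] at h3
      rw [(mul_eq_zero.1 h3).resolve_right h2, mul_zero]
  have hterm : ∀ k : ℕ, (k : ℝ) * ‖logCoeff x (N * l) k - s k‖ =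
      ‖(if l ∣ k then N * l * w ^ k else 0) - k * s k‖ *
      if k = 0 then 0 else 1 := by
    intro k
    rcases eq_or_ne k 0 with rfl | hk
    · simp
    · rw [if_neg hk, mul_one, ← hsum, ← natCast_mul_logCoeff x _ hk, ← mul_sub, norm_mul,
        Complex.norm_natCast]
  have hinj : Function.Injective fun q : ℕ => l * (q + 2) := fun p q h => by
    simpa [hl] using h
  have hoff : ∀ k ∉ Set.range fun q : ℕ => l * (q + 2),
      (k : ℝ) * ‖logCoeff x (N * l) k - s k‖ = 0 := by
    intro k hk
    rw [hterm]
    rcases eq_or_ne k 0 with rfl | hk0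
    · simp
    rw [if_neg hk0, mul_one, norm_eq_zero]
    rcases eq_or_ne k l with rfl | hkl
    · rw [if_pos dvd_rfl, hw, hs, Pi.single_eq_same]
      field_simp
      ring
    · rw [hs, Pi.single_eq_of_ne hkl, mul_zero, sub_zero, if_neg]
      rintro ⟨q, rfl⟩
      have hq0 : q ≠ 0 := by rintro rfl; simp at hk0
      have hq1 : q ≠ 1 := by rintro rfl; simp at hkl
      exact hk ⟨q - 2, by simp only; congr 1; omega⟩
  have hon : ∀ q : ℕ, ((l * (q + 2) : ℕ) : ℝ) *
      ‖logCoeff x (N * l) (l * (q + 2)) - s (l * (q + 2))‖ =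
      (l : ℝ) * ‖a‖ * (‖a‖ / N) * (‖a‖ / N) ^ q := by
    intro q
    have hne : l * (q + 2) ≠ l := fun h => by
      have := Nat.eq_of_mul_eq_mul_left (Nat.pos_of_ne_zero hl) (h.trans (mul_one l).symm)
      omega
    have hne0 : l * (q + 2) ≠ 0 := by positivity
    have hNR : (N : ℝ) ≠ 0 := by exact_mod_cast hN0.ne'
    rw [hterm, if_neg hne0, if_pos (dvd_mul_right _ _), hs, Pi.single_eq_of_ne hne, mul_zero, sub_zero,
      mul_one, norm_mul, norm_mul, pow_mul, hw, norm_pow, norm_div, Complex.norm_natCast,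
      Complex.norm_natCast, pow_add]
    field_simp
  have hhas : HasSum (fun k : ℕ => (k : ℝ) * ‖logCoeff x (N * l) k - s k‖)
      ((l : ℝ) * ‖a‖ * (‖a‖ / N) * (1 - ‖a‖ / N)⁻¹) := by
    rw [← hinj.hasSum_iff hoff]
    have := (hasSum_geometric_of_lt_one (by positivity) hN1).mul_left ((l : ℝ) * ‖a‖ * (‖a‖ / N))
    simpa only [Function.comp_def, hon] using this
  refine ⟨x, N * l, ⟨fun i hi => if_neg (not_lt.2 hi), (‖w‖ + 1) / 2, by linarith, fun i => ?_⟩,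
    hhas.summable, hhas.tsum_eq ▸ hN⟩
  simp only [hx]
  split_ifs
  · rw [norm_mul, norm_pow, hζn, one_pow, mul_one]
    linarith
  · rw [norm_zero]
    linarith [norm_nonneg w]

theorem isLogApprox_truncation {b : ℕ → ℂ} (h0 : b 0 = 0) (M : ℕ) :
    IsLogApprox fun k => if k < M then b k else 0 := by
  induction M with
  | zero =>
    simp only [Nat.not_lt_zero, if_false]
    exact IsLogApprox.zero
  | succ M ih =>
    rcases eq_or_ne M 0 with rfl | hM
    · convert IsLogApprox.zero using 1
      funext k
      simp only [zero_add, Nat.lt_one_iff, Pi.zero_apply]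
      split_ifs with hk
      · rw [hk, h0]
      · rfl
    · convert ih.add (IsLogApprox.single hM (b M)) using 1
      funext k
      rw [Pi.add_apply]
      rcases lt_trichotomy k M with hk | rfl | hk
      · simp [hk, hk.ne, Nat.lt_succ_of_lt hk]
      · simp
      · rw [if_neg (by omega), if_neg (by omega), Pi.single_eq_of_ne hk.ne', zero_add]

theorem tendsto_tsum_truncation {w : ℕ → ℝ} {g : ℂ → ℝ} {b : ℕ → ℂ} (hw : ∀ k, 0 ≤ w k)
    (hg : ∀ z, g (-z) = g z) (hg0 : g 0 = 0) (hgn : ∀ z, 0 ≤ g z)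
    (hb : Summable fun k => w k * g (b k)) :
    Filter.Tendsto (fun M : ℕ => ∑' k, w k * g ((if k < M then b k else 0) - b k))
      Filter.atTop (nhds 0) := by
  rw [show nhds (0 : ℝ) = nhds (∑' _ : ℕ, 0) by rw [tsum_zero]]
  refine tendsto_tsum_of_dominated_convergence hb (fun k => ?_) (.of_forall fun M k => ?_)
  · refine tendsto_const_nhds.congr' ?_
    filter_upwards [Filter.eventually_gt_atTop k] with M hM
    simp [hM, hg0]
  · split_ifs
    · simpa [hg0] using mul_nonneg (hw k) (hgn _)
    · rw [zero_sub, hg, Real.norm_of_nonneg (mul_nonneg (hw k) (hgn _))]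

theorem natCast_mul_norm_add_sq_le (k : ℕ) (u v : ℂ) :
    (k : ℝ) * ‖u + v‖ ^ 2 ≤ 2 * (k * ‖u‖ ^ 2) + 2 * (k * ‖v‖ ^ 2) := by
  have h1 : ‖u + v‖ ^ 2 ≤ (‖u‖ + ‖v‖) ^ 2 := by gcongr; exact norm_add_le _ _
  have h2 : ‖u + v‖ ^ 2 ≤ 2 * ‖u‖ ^ 2 + 2 * ‖v‖ ^ 2 := by nlinarith [sq_nonneg (‖u‖ - ‖v‖)]
  nlinarith [mul_le_mul_of_nonneg_left h2 (Nat.cast_nonneg (α := ℝ) k)]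

theorem exists_logCoeff_approx {b : ℕ → ℂ} (h0 : b 0 = 0) (hb : Summable fun k => ‖b k‖)
    (hb2 : Summable fun k : ℕ => (k : ℝ) * ‖b k‖ ^ 2) {ε : ℝ} (hε : 0 < ε) :
    ∃ x m, IsNodes x m ∧ ∑' k, ‖logCoeff x m k - b k‖ < ε ∧
      ∑' k : ℕ, (k : ℝ) * ‖logCoeff x m k - b k‖ ^ 2 < ε := by
  have h1 := tendsto_tsum_truncation (w := fun _ => 1) (g := fun z => ‖z‖) (b := b)
    (fun _ => zero_le_one) norm_neg norm_zero norm_nonneg (by simpa using hb)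
  have h2 := tendsto_tsum_truncation (w := fun k : ℕ => (k : ℝ)) (g := fun z => ‖z‖ ^ 2) (b := b)
    (fun _ => by positivity) (by simp) (by simp) (fun _ => by positivity) hb2
  obtain ⟨M, hM1, hM2⟩ := ((h1.eventually_lt_const (by positivity : 0 < ε / 4)).and
    (h2.eventually_lt_const (by positivity : 0 < ε / 4))).exists
  set t : ℕ → ℂ := fun k => if k < M then b k else 0 with ht
  have hη : 0 < min 1 (ε / 4) := lt_min one_pos (by positivity)
  obtain ⟨x, m, hx, hs, hlt⟩ := isLogApprox_truncation h0 M _ hη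
  set S := ∑' k : ℕ, (k : ℝ) * ‖logCoeff x m k - t k‖ with hS
  have ht0 : logCoeff x m 0 - t 0 = 0 := by simp [ht, logCoeff_zero, h0]
  have hS0 : 0 ≤ S := tsum_nonneg fun k => by positivity
  have hu1 := summable_norm_of_natCast_mul (δ := fun k => logCoeff x m k - t k) ht0 hs
  have hu2 := summable_natCast_mul_norm_sq (δ := fun k => logCoeff x m k - t k) ht0 hs
  have hu1S : ∑' k, ‖logCoeff x m k - t k‖ ≤ S :=
    hu1.tsum_le_tsum (norm_le_natCast_mul_norm (δ := fun k => logCoeff x m k - t k) ht0) hs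
  have hu2S : ∑' k : ℕ, (k : ℝ) * ‖logCoeff x m k - t k‖ ^ 2 ≤ S * S := by
    refine (hu2.tsum_le_tsum (natCast_mul_norm_sq_le (δ := fun k => logCoeff x m k - t k) ht0 hs)
      (hs.mul_left _)).trans_eq ?_
    rw [tsum_mul_left]
  have hle : ∀ k, ‖t k - b k‖ ≤ ‖b k‖ := fun k => by
    simp only [ht]
    split_ifs <;> simp
  have hv1 : Summable fun k => ‖t k - b k‖ := .of_nonneg_of_le (fun _ => norm_nonneg _) hle hb
  have hv2 : Summable fun k : ℕ => (k : ℝ) * ‖t k - b k‖ ^ 2 :=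
    .of_nonneg_of_le (fun _ => by positivity) (fun k => by gcongr; exact hle k) hb2
  have hd1 : ∀ k, ‖logCoeff x m k - b k‖ ≤ ‖logCoeff x m k - t k‖ + ‖t k - b k‖ := fun k =>
    norm_sub_le_norm_sub_add_norm_sub _ _ _
  have hd2 : ∀ k : ℕ, (k : ℝ) * ‖logCoeff x m k - b k‖ ^ 2 ≤
      2 * (k * ‖logCoeff x m k - t k‖ ^ 2) + 2 * (k * ‖t k - b k‖ ^ 2) := fun k => by
    rw [← sub_add_sub_cancel (logCoeff x m k) (t k) (b k)]
    exact natCast_mul_norm_add_sq_le _ _ _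
  have hηε : S < ε / 4 := hlt.trans_le (min_le_right _ _)
  have hη1 : S < 1 := hlt.trans_le (min_le_left _ _)
  simp only [one_mul] at hM1
  refine ⟨x, m, hx, ?_, ?_⟩
  · have hsum := Summable.of_nonneg_of_le (fun _ => norm_nonneg _) hd1 (hu1.add hv1)
    have := hsum.tsum_le_tsum hd1 (hu1.add hv1)
    rw [hu1.tsum_add hv1] at this
    linarith
  · have hsum := Summable.of_nonneg_of_le (fun _ => by positivity) hd2
      ((hu2.mul_left 2).add (hv2.mul_left 2))
    have := hsum.tsum_le_tsum hd2 ((hu2.mul_left 2).add (hv2.mul_left 2))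
    rw [(hu2.mul_left 2).tsum_add (hv2.mul_left 2), tsum_mul_left, tsum_mul_left] at this
    nlinarith

/-- A sequence of node families whose logarithmic coefficients converge to `b` in `ℓ¹` and in
the `ℓ²` space with weights `k`. -/
structure LogApproxSeq (b : ℕ → ℂ) (x : ℕ → ℕ → ℂ) (m : ℕ → ℕ) : Prop where
  isNodes : ∀ r, IsNodes (x r) (m r)
  tendsto_norm : Filter.Tendsto (fun r => ∑' k, ‖logCoeff (x r) (m r) k - b k‖)
    Filter.atTop (nhds 0)
  tendsto_norm_sq : Filter.Tendsto
    (fun r => ∑' k : ℕ, (k : ℝ) * ‖logCoeff (x r) (m r) k - b k‖ ^ 2) Filter.atTop (nhds 0)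

theorem exists_logApproxSeq {b : ℕ → ℂ} (h0 : b 0 = 0) (hb : Summable fun k => ‖b k‖)
    (hb2 : Summable fun k : ℕ => (k : ℝ) * ‖b k‖ ^ 2) : ∃ x m, LogApproxSeq b x m := by
  choose x m hx h1 h2 using fun r : ℕ =>
    exists_logCoeff_approx h0 hb hb2 (Nat.one_div_pos_of_nat (α := ℝ) (n := r))
  exact ⟨x, m, hx,
    squeeze_zero (fun r => tsum_nonneg fun k => norm_nonneg _) (fun r => (h1 r).le)
      tendsto_one_div_add_atTop_nhds_zero_nat,
    squeeze_zero (fun r => tsum_nonneg fun k => by positivity) (fun r => (h2 r).le)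
      tendsto_one_div_add_atTop_nhds_zero_nat⟩

/-- The sequence `√k * b k` as a vector of `ℓ²`. -/
noncomputable def weightedVec (b : ℕ → ℂ) (hb : Summable fun k : ℕ => (k : ℝ) * ‖b k‖ ^ 2) :
    lp (fun _ : ℕ => ℂ) 2 :=
  ⟨fun k => (√k : ℝ) * b k, by
    refine (memℓp_gen_iff (by norm_num)).2 (hb.congr fun k => ?_)
    simp [mul_pow]⟩

theorem weightedVec_apply {b : ℕ → ℂ} (hb : Summable fun k : ℕ => (k : ℝ) * ‖b k‖ ^ 2) (k : ℕ) :
    weightedVec b hb k = (√k : ℝ) * b k := rfl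

theorem inner_weightedVec {c d : ℕ → ℂ} (hc : Summable fun k : ℕ => (k : ℝ) * ‖c k‖ ^ 2)
    (hd : Summable fun k : ℕ => (k : ℝ) * ‖d k‖ ^ 2) :
    inner ℂ (weightedVec d hd) (weightedVec c hc) = ∑' k : ℕ, k * star (d k) * c k := by
  rw [lp.inner_eq_tsum]
  refine tsum_congr fun k => ?_
  have h : ((√k : ℝ) : ℂ) * (√k : ℝ) = k := by
    rw [← Complex.ofReal_mul, Real.mul_self_sqrt (Nat.cast_nonneg k), Complex.ofReal_natCast]
  rw [weightedVec_apply, weightedVec_apply, RCLike.inner_apply, map_mul, Complex.conj_ofReal, ← h]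
  simp only [RCLike.star_def]
  ring

theorem norm_weightedVec_sub_sq {c d : ℕ → ℂ} (hc : Summable fun k : ℕ => (k : ℝ) * ‖c k‖ ^ 2)
    (hd : Summable fun k : ℕ => (k : ℝ) * ‖d k‖ ^ 2) :
    ‖weightedVec c hc - weightedVec d hd‖ ^ 2 = ∑' k : ℕ, (k : ℝ) * ‖c k - d k‖ ^ 2 := by
  have h := lp.norm_rpow_eq_tsum (p := 2) (by norm_num) (weightedVec c hc - weightedVec d hd)
  norm_num at h
  rw [h]
  refine tsum_congr fun k => ?_
  rw [weightedVec_apply, weightedVec_apply, ← mul_sub, norm_mul, mul_pow]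
  simp

theorem IsNodes.summable_natCast_mul_norm_sq {x : ℕ → ℂ} {m : ℕ} (hx : IsNodes x m) :
    Summable fun k : ℕ => (k : ℝ) * ‖logCoeff x m k‖ ^ 2 :=
  _root_.summable_natCast_mul_norm_sq (logCoeff_zero x m)
    (summable_natCast_mul_norm_logCoeff hx.norm_lt_one m)

/-- The vector of `ℓ²` attached to the logarithmic coefficients of a family of nodes. -/
noncomputable def nodeVec {x : ℕ → ℂ} {m : ℕ} (hx : IsNodes x m) : lp (fun _ : ℕ => ℂ) 2 :=
  weightedVec (logCoeff x m) hx.summable_natCast_mul_norm_sq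

theorem LogApproxSeq.tendsto_nodeVec {b : ℕ → ℂ} {x : ℕ → ℕ → ℂ} {m : ℕ → ℕ}
    (h : LogApproxSeq b x m) (hb : Summable fun k : ℕ => (k : ℝ) * ‖b k‖ ^ 2) :
    Filter.Tendsto (fun r => nodeVec (h.isNodes r)) Filter.atTop (nhds (weightedVec b hb)) := by
  rw [tendsto_iff_norm_sub_tendsto_zero]
  have := h.tendsto_norm_sq.sqrt
  rw [Real.sqrt_zero] at this
  refine this.congr fun r => ?_
  rw [nodeVec, ← norm_weightedVec_sub_sq _ hb, Real.sqrt_sq (norm_nonneg _)]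

theorem toeplitzGram_eq_exp_inner {x y : ℕ → ℂ} {m m' n : ℕ} (hx : IsNodes x m)
    (hy : IsNodes y m') (hm : m ≤ n) :
    toeplitzGram (geomProdCoeff y m') (geomProdCoeff x m) n =
      Complex.exp (inner ℂ (nodeVec hy) (nodeVec hx)) := by
  rw [toeplitzGram_eq_exp hx hy hm, nodeVec, nodeVec, inner_weightedVec]

/-- The squared distance between `exp u` and `α * exp v` for the reproducing kernel
`exp (inner u v)`. -/
noncomputable def expDistSq (u v : lp (fun _ : ℕ => ℂ) 2) (α : ℂ) : ℝ :=
  (Complex.exp (inner ℂ u u)).re - 2 * (α * Complex.exp (inner ℂ u v)).re +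
    ‖α‖ ^ 2 * (Complex.exp (inner ℂ v v)).re

theorem continuous_expDistSq (α : ℂ) :
    Continuous fun p : lp (fun _ : ℕ => ℂ) 2 × lp (fun _ : ℕ => ℂ) 2 =>
      expDistSq p.1 p.2 α := by
  unfold expDistSq
  fun_prop

theorem expDistSq_self_one (u : lp (fun _ : ℕ => ℂ) 2) : expDistSq u u 1 = 0 := by
  simp only [expDistSq, one_mul, norm_one, one_pow]
  ring

theorem gramDistSq_le_expDistSq {x y : ℕ → ℂ} {m m' : ℕ} (hx : IsNodes x m) (hy : IsNodes y m')
    (α : ℂ) (n : ℕ) :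
    gramDistSq (geomProdCoeff x m) (geomProdCoeff y m') α n ≤
      expDistSq (nodeVec hx) (nodeVec hy) α := by
  have hmono := gramDistSq_monotone (summable_norm_geomProdCoeff hx.norm_lt_one m)
    (summable_norm_geomProdCoeff hy.norm_lt_one m') (geomProdCoeff_zero x m)
    (geomProdCoeff_zero y m') α
  refine (hmono (show n ≤ n + m + m' by omega)).trans_eq ?_
  rw [gramDistSq, expDistSq, toeplitzGram_eq_exp_inner hx hx (by omega),
    toeplitzGram_eq_exp_inner hy hx (by omega), toeplitzGram_eq_exp_inner hy hy (by omega)]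

/-- A bound for the distance of two Toeplitz determinants which does not depend on their size. -/
noncomputable def gramBound (p q : lp (fun _ : ℕ => ℂ) 2 × lp (fun _ : ℕ => ℂ) 2) : ℝ :=
  √(expDistSq p.1 q.1 1) * √(expDistSq p.2 p.2 0) +
    √(expDistSq q.1 q.1 0) * √(expDistSq p.2 q.2 1)

theorem norm_toeplitzGram_sub_le_gramBound {x x' y y' : ℕ → ℂ} {m m' l l' : ℕ}
    (hx : IsNodes x m) (hx' : IsNodes x' m') (hy : IsNodes y l) (hy' : IsNodes y' l') (n : ℕ) :
    ‖toeplitzGram (geomProdCoeff y l) (geomProdCoeff x m) n -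
      toeplitzGram (geomProdCoeff y' l') (geomProdCoeff x' m') n‖ ≤
      gramBound (nodeVec hy, nodeVec hx) (nodeVec hy', nodeVec hx') := by
  refine (norm_toeplitzGram_sub_le (summable_norm_geomProdCoeff hy.norm_lt_one l)
    (summable_norm_geomProdCoeff hy'.norm_lt_one l')
    (summable_norm_geomProdCoeff hx.norm_lt_one m)
    (summable_norm_geomProdCoeff hx'.norm_lt_one m') n).trans ?_
  unfold gramBound
  gcongr
  · exact gramDistSq_le_expDistSq hy hy' 1 n
  · exact gramDistSq_le_expDistSq hx hx 0 n
  · exact gramDistSq_le_expDistSq hy' hy' 0 n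
  · exact gramDistSq_le_expDistSq hx hx' 1 n

theorem tendsto_gramBound {ι : Type*} {l : Filter ι}
    {u : ι → lp (fun _ : ℕ => ℂ) 2 × lp (fun _ : ℕ => ℂ) 2}
    {p : lp (fun _ : ℕ => ℂ) 2 × lp (fun _ : ℕ => ℂ) 2} (h : Filter.Tendsto u l (nhds p)) :
    Filter.Tendsto (fun q : ι × ι => gramBound (u q.1) (u q.2)) (l ×ˢ l) (nhds 0) := by
  have hc : Continuous fun q : (lp (fun _ : ℕ => ℂ) 2 × lp (fun _ : ℕ => ℂ) 2) ×
      (lp (fun _ : ℕ => ℂ) 2 × lp (fun _ : ℕ => ℂ) 2) => gramBound q.1 q.2 := by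
    have h1 := continuous_expDistSq 1
    have h0 := continuous_expDistSq 0
    unfold gramBound
    fun_prop
  have := (hc.tendsto (p, p)).comp ((h.comp Filter.tendsto_fst).prodMk_nhds
    (h.comp Filter.tendsto_snd))
  simpa [gramBound, expDistSq_self_one, Function.comp_def] using this

theorem tendsto_of_tendsto_toeplitzGram {b b' : ℕ → ℂ} {x y : ℕ → ℕ → ℂ} {m m' : ℕ → ℕ}
    (hx : LogApproxSeq b x m) (hy : LogApproxSeq b' y m')
    (hb : Summable fun k : ℕ => (k : ℝ) * ‖b k‖ ^ 2)
    (hb' : Summable fun k : ℕ => (k : ℝ) * ‖b' k‖ ^ 2) {D : ℕ → ℂ}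
    (hD : ∀ n, Filter.Tendsto
      (fun r => toeplitzGram (geomProdCoeff (y r) (m' r)) (geomProdCoeff (x r) (m r)) n)
      Filter.atTop (nhds (D n))) :
    Filter.Tendsto D Filter.atTop (nhds (Complex.exp (∑' k : ℕ, k * star (b' k) * b k))) := by
  have hU := hx.tendsto_nodeVec hb
  have hV := hy.tendsto_nodeVec hb'
  have hcauchy : UniformCauchySeqOn
      (fun r n => toeplitzGram (geomProdCoeff (y r) (m' r)) (geomProdCoeff (x r) (m r)) n)
      Filter.atTop Set.univ := by
    rw [Metric.uniformCauchySeqOn_iff]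
    intro ε hε
    have h := (tendsto_gramBound (hV.prodMk_nhds hU)).eventually_lt_const hε
    rw [Filter.prod_atTop_atTop_eq, Filter.eventually_atTop] at h
    obtain ⟨N, hN⟩ := h
    refine ⟨max N.1 N.2, fun r hr s hs n _ => ?_⟩
    rw [dist_eq_norm]
    exact (norm_toeplitzGram_sub_le_gramBound (hx.isNodes r) (hx.isNodes s) (hy.isNodes r)
      (hy.isNodes s) n).trans_lt
      (hN (r, s) ⟨(le_max_left _ _).trans hr, (le_max_right _ _).trans hs⟩)
  have hunif := (hcauchy.tendstoUniformlyOn_of_tendsto fun n _ => hD n)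
  rw [tendstoUniformlyOn_iff_tendstoUniformlyOnFilter, Filter.principal_univ] at hunif
  refine (hunif.mono_right le_top).tendsto_of_eventually_tendsto
    (L := fun r => Complex.exp (inner ℂ (nodeVec (hy.isNodes r)) (nodeVec (hx.isNodes r))))
    (.of_forall fun r => ?_) ?_
  · refine tendsto_const_nhds.congr' ?_
    filter_upwards [Filter.eventually_ge_atTop (m r)] with n hn
    exact (toeplitzGram_eq_exp_inner (hx.isNodes r) (hy.isNodes r) hn).symm
  · rw [← inner_weightedVec hb hb']
    exact (Complex.continuous_exp.tendsto _).comp (hV.inner hU)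

theorem norm_mul_exp_pow (a : ℂ) (θ : ℝ) (k : ℕ) :
    ‖a * Complex.exp (θ * Complex.I) ^ k‖ = ‖a‖ := by
  rw [norm_mul, norm_pow, Complex.norm_exp_ofReal_mul_I, one_pow, mul_one]

theorem continuous_tsum_mul_exp_pow {a : ℕ → ℂ} (ha : Summable fun k => ‖a k‖) :
    Continuous fun θ : ℝ => ∑' k, a k * Complex.exp (θ * Complex.I) ^ k :=
  continuous_tsum (fun k => by fun_prop) ha fun k θ => (norm_mul_exp_pow _ _ _).le

theorem hasSum_integral_mul_exp_pow_mul {a : ℕ → ℂ} (ha : Summable fun k => ‖a k‖) {h : ℝ → ℂ}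
    (hh : Continuous h) :
    HasSum (fun k => ∫ θ in -π..π, a k * Complex.exp (θ * Complex.I) ^ k * h θ)
      (∫ θ in -π..π, (∑' k, a k * Complex.exp (θ * Complex.I) ^ k) * h θ) := by
  refine intervalIntegral.hasSum_integral_of_dominated_convergence (fun k θ => ‖a k‖ * ‖h θ‖)
    (fun k => ?_) (fun k => ?_) ?_ ?_ ?_
  · exact Continuous.aestronglyMeasurable (by fun_prop)
  · exact .of_forall fun θ _ => by rw [norm_mul, norm_mul_exp_pow]
  · exact .of_forall fun θ _ => ha.mul_right _
  · simp_rw [tsum_mul_right]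
    exact (hh.norm.const_mul _).intervalIntegrable _ _
  · refine .of_forall fun θ _ => HasSum.mul_right _ (Summable.of_norm ?_).hasSum
    simpa only [norm_mul_exp_pow] using ha

theorem integral_exp_pow_mul_star (j k : ℕ) :
    ∫ θ in -π..π, Complex.exp (θ * Complex.I) ^ j * star (Complex.exp (θ * Complex.I) ^ k) =
      if j = k then 2 * (π : ℂ) else 0 := by
  have h : ∀ θ : ℝ, Complex.exp (θ * Complex.I) ^ j * star (Complex.exp (θ * Complex.I) ^ k) =
      Complex.exp (((j - k : ℤ) : ℂ) * Complex.I * θ) := by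
    intro θ
    rw [star_pow, RCLike.star_def, ← Complex.exp_conj, ← Complex.exp_nat_mul, ← Complex.exp_nat_mul,
      ← Complex.exp_add]
    congr 1
    simp
    ring
  simp_rw [h]
  split_ifs with hjk
  · subst hjk
    simp
    ring
  · have hc : ((j - k : ℤ) : ℂ) * Complex.I ≠ 0 := by
      refine mul_ne_zero ?_ Complex.I_ne_zero
      exact Int.cast_ne_zero.2 (sub_ne_zero.2 (Nat.cast_injective.ne hjk))
    have hper : Complex.exp (((j - k : ℤ) : ℂ) * Complex.I * (π : ℝ)) =
        Complex.exp (((j - k : ℤ) : ℂ) * Complex.I * ((-π : ℝ) : ℂ)) := by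
      rw [← mul_one (Complex.exp (_ * ((-π : ℝ) : ℂ))),
        ← Complex.exp_int_mul_two_pi_mul_I (j - k : ℤ), ← Complex.exp_add]
      congr 1
      push_cast
      ring
    rw [integral_exp_mul_complex hc, hper, sub_self, zero_div]

theorem integral_tsum_mul_star_exp_pow {a : ℕ → ℂ} (ha : Summable fun k => ‖a k‖) (k : ℕ) :
    ∫ θ in -π..π, (∑' j, a j * Complex.exp (θ * Complex.I) ^ j) *
      star (Complex.exp (θ * Complex.I) ^ k) = a k * (2 * π) := by
  rw [← (hasSum_integral_mul_exp_pow_mul ha (by fun_prop)).tsum_eq, tsum_eq_single k]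
  · simp_rw [mul_assoc]
    rw [intervalIntegral.integral_const_mul, integral_exp_pow_mul_star, if_pos rfl]
  · intro j hj
    simp_rw [mul_assoc]
    rw [intervalIntegral.integral_const_mul, integral_exp_pow_mul_star, if_neg hj, mul_zero]

theorem integral_star (f : ℝ → ℂ) (s t : ℝ) :
    ∫ θ in s..t, star (f θ) = star (∫ θ in s..t, f θ) := by
  simp only [intervalIntegral, RCLike.star_def, integral_conj, map_sub]

theorem integral_tsum_mul_star_tsum {a c : ℕ → ℂ} (ha : Summable fun k => ‖a k‖)
    (hc : Summable fun k => ‖c k‖) :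
    ∫ θ in -π..π, (∑' k, a k * Complex.exp (θ * Complex.I) ^ k) *
      star (∑' k, c k * Complex.exp (θ * Complex.I) ^ k) = 2 * π * ∑' k, star (c k) * a k := by
  rw [← (hasSum_integral_mul_exp_pow_mul ha
    (h := fun θ => star (∑' k, c k * Complex.exp (θ * Complex.I) ^ k))
    (continuous_star.comp (continuous_tsum_mul_exp_pow hc))).tsum_eq, ← tsum_mul_left]
  refine tsum_congr fun k => ?_
  have h : ∀ θ : ℝ, a k * Complex.exp (θ * Complex.I) ^ k *
      star (∑' k, c k * Complex.exp (θ * Complex.I) ^ k) =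
      a k * star ((∑' j, c j * Complex.exp (θ * Complex.I) ^ j) *
        star (Complex.exp (θ * Complex.I) ^ k)) := by
    intro θ
    rw [star_mul, star_star, mul_assoc]
  simp_rw [h]
  rw [intervalIntegral.integral_const_mul, integral_star, integral_tsum_mul_star_exp_pow hc]
  simp
  ring

theorem tsum_toeplitzEntry_mul_pow (c : ℕ → ℂ) (z : ℂ) (q : ℕ) :
    ∑' k, toeplitzEntry c k q * z ^ k = z ^ q * ∑' k, c k * z ^ k := by
  rw [← tsum_mul_left, ← (add_left_injective q).tsum_eq]
  · refine tsum_congr fun k => ?_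
    simp [toeplitzEntry, pow_add]
    ring
  · intro k hk
    rcases lt_or_ge k q with h | h
    · simp [toeplitzEntry, not_le.2 h] at hk
    · exact ⟨k - q, Nat.sub_add_cancel h⟩

theorem integral_mul_star_eq_toeplitz {c d : ℕ → ℂ} (hc : Summable fun k => ‖c k‖)
    (hd : Summable fun k => ‖d k‖) (p q : ℕ) :
    1 / (2 * (π : ℂ)) * ∫ θ in -π..π, (∑' k, c k * Complex.exp (θ * Complex.I) ^ k) *
      star (∑' k, d k * Complex.exp (θ * Complex.I) ^ k) *
        Complex.exp (-((((p : ℤ) - q : ℤ) : ℂ) * θ * Complex.I)) =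
      ∑' k, star (toeplitzEntry d k p) * toeplitzEntry c k q := by
  have h : ∀ θ : ℝ, (∑' k, c k * Complex.exp (θ * Complex.I) ^ k) *
      star (∑' k, d k * Complex.exp (θ * Complex.I) ^ k) *
        Complex.exp (-((((p : ℤ) - q : ℤ) : ℂ) * θ * Complex.I)) =
      (∑' k, toeplitzEntry c k q * Complex.exp (θ * Complex.I) ^ k) *
        star (∑' k, toeplitzEntry d k p * Complex.exp (θ * Complex.I) ^ k) := by
    intro θ
    have he : Complex.exp (-((((p : ℤ) - q : ℤ) : ℂ) * θ * Complex.I)) =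
        Complex.exp (θ * Complex.I) ^ q * star (Complex.exp (θ * Complex.I) ^ p) := by
      rw [star_pow, RCLike.star_def, ← Complex.exp_conj, ← Complex.exp_nat_mul,
        ← Complex.exp_nat_mul, ← Complex.exp_add]
      congr 1
      simp
      ring
    rw [tsum_toeplitzEntry_mul_pow, tsum_toeplitzEntry_mul_pow, star_mul, he]
    ring
  simp_rw [h]
  rw [integral_tsum_mul_star_tsum (summable_norm_toeplitzEntry hc q)
    (summable_norm_toeplitzEntry hd p), ← mul_assoc, one_div, inv_mul_cancel₀, one_mul]
  exact mul_ne_zero two_ne_zero (by exact_mod_cast Real.pi_ne_zero)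

/-- The function `θ ↦ exp (∑ b k * exp (i k θ))`. -/
noncomputable def expSeries (b : ℕ → ℂ) (θ : ℝ) : ℂ :=
  Complex.exp (∑' k, b k * Complex.exp (θ * Complex.I) ^ k)

theorem continuous_expSeries {b : ℕ → ℂ} (hb : Summable fun k => ‖b k‖) :
    Continuous (expSeries b) :=
  Complex.continuous_exp.comp (continuous_tsum_mul_exp_pow hb)

/-- The Fourier coefficients of `expSeries b * star (expSeries b')`. -/
noncomputable def expSeriesCoeff (b b' : ℕ → ℂ) (k : ℤ) : ℂ :=
  1 / (2 * (π : ℂ)) * ∫ θ in -π..π, expSeries b θ * star (expSeries b' θ) *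
    Complex.exp (-((k : ℂ) * θ * Complex.I))

theorem summable_norm_logCoeff {x : ℕ → ℂ} (hx : ∀ i, ‖x i‖ < 1) (m : ℕ) :
    Summable fun k => ‖logCoeff x m k‖ :=
  summable_norm_of_natCast_mul (logCoeff_zero x m) (summable_natCast_mul_norm_logCoeff hx m)

theorem expSeries_logCoeff {x : ℕ → ℂ} (hx : ∀ i, ‖x i‖ < 1) (m : ℕ) (θ : ℝ) :
    expSeries (logCoeff x m) θ = ∑' k, geomProdCoeff x m k * Complex.exp (θ * Complex.I) ^ k := by
  have hz : ‖Complex.exp (θ * Complex.I)‖ ≤ 1 := (Complex.norm_exp_ofReal_mul_I θ).le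
  rw [expSeries, exp_tsum_logCoeff hx m hz, tsum_geomProdCoeff_mul_pow hx m hz]

theorem toeplitzGram_eq_det_expSeriesCoeff {x y : ℕ → ℂ} (hx : ∀ i, ‖x i‖ < 1)
    (hy : ∀ i, ‖y i‖ < 1) (m m' n : ℕ) :
    toeplitzGram (geomProdCoeff y m') (geomProdCoeff x m) n =
      (Matrix.of fun i j : Fin n =>
        expSeriesCoeff (logCoeff x m) (logCoeff y m') ((i : ℤ) - (j : ℤ))).det := by
  rw [toeplitzGram]
  congr 1
  ext i j
  rw [Matrix.of_apply, Matrix.of_apply, expSeriesCoeff,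
    ← integral_mul_star_eq_toeplitz (summable_norm_geomProdCoeff hx m)
      (summable_norm_geomProdCoeff hy m')]
  simp_rw [expSeries_logCoeff hx, expSeries_logCoeff hy]

theorem norm_tsum_mul_exp_pow_sub_le {a b : ℕ → ℂ} (ha : Summable fun k => ‖a k‖)
    (hb : Summable fun k => ‖b k‖) (θ : ℝ) :
    ‖∑' k, a k * Complex.exp (θ * Complex.I) ^ k - ∑' k, b k * Complex.exp (θ * Complex.I) ^ k‖ ≤
      ∑' k, ‖a k - b k‖ := by
  have hs : ∀ {c : ℕ → ℂ}, (Summable fun k => ‖c k‖) →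
      Summable fun k => ‖c k * Complex.exp (θ * Complex.I) ^ k‖ := fun h => by
    simpa only [norm_mul_exp_pow] using h
  have hab : Summable fun k => ‖a k - b k‖ :=
    .of_nonneg_of_le (fun _ => norm_nonneg _) (fun k => norm_sub_le _ _) (ha.add hb)
  rw [← (hs ha).of_norm.tsum_sub (hs hb).of_norm]
  simp_rw [← sub_mul]
  refine (norm_tsum_le_tsum_norm (hs hab)).trans_eq ?_
  simp_rw [norm_mul_exp_pow]

theorem LogApproxSeq.tendsto_expSeries {b : ℕ → ℂ} {x : ℕ → ℕ → ℂ} {m : ℕ → ℕ}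
    (h : LogApproxSeq b x m) (hb : Summable fun k => ‖b k‖) (θ : ℝ) :
    Filter.Tendsto (fun r => expSeries (logCoeff (x r) (m r)) θ) Filter.atTop
      (nhds (expSeries b θ)) := by
  refine (Complex.continuous_exp.tendsto _).comp ?_
  rw [tendsto_iff_norm_sub_tendsto_zero]
  exact squeeze_zero (fun r => norm_nonneg _) (fun r => norm_tsum_mul_exp_pow_sub_le
    (summable_norm_logCoeff (h.isNodes r).norm_lt_one _) hb θ) h.tendsto_norm

theorem LogApproxSeq.eventually_norm_expSeries_le {b : ℕ → ℂ} {x : ℕ → ℕ → ℂ} {m : ℕ → ℕ}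
    (h : LogApproxSeq b x m) (hb : Summable fun k => ‖b k‖) :
    ∃ C, ∀ᶠ r in Filter.atTop, ∀ θ, ‖expSeries (logCoeff (x r) (m r)) θ‖ ≤ C := by
  refine ⟨Real.exp (1 + ∑' k, ‖b k‖), ?_⟩
  filter_upwards [h.tendsto_norm.eventually_lt_const one_pos] with r hr θ
  have h1 := norm_tsum_mul_exp_pow_sub_le
    (summable_norm_logCoeff (h.isNodes r).norm_lt_one (m r)) hb θ
  have h2 : ‖∑' k, b k * Complex.exp (θ * Complex.I) ^ k‖ ≤ ∑' k, ‖b k‖ := by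
    refine (norm_tsum_le_tsum_norm ?_).trans_eq ?_ <;> simp_rw [norm_mul_exp_pow]
    exact hb
  rw [expSeries]
  refine (Complex.norm_exp_le_exp_norm _).trans (Real.exp_le_exp.2 ?_)
  refine (norm_le_norm_sub_add _ _).trans (add_le_add (h1.trans hr.le) h2)

theorem tendsto_expSeriesCoeff {b b' : ℕ → ℂ} {x y : ℕ → ℕ → ℂ} {m m' : ℕ → ℕ}
    (hx : LogApproxSeq b x m) (hy : LogApproxSeq b' y m') (hb : Summable fun k => ‖b k‖)
    (hb' : Summable fun k => ‖b' k‖) (k : ℤ) :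
    Filter.Tendsto
      (fun r => expSeriesCoeff (logCoeff (x r) (m r)) (logCoeff (y r) (m' r)) k)
      Filter.atTop (nhds (expSeriesCoeff b b' k)) := by
  obtain ⟨C, hC⟩ := hx.eventually_norm_expSeries_le hb
  obtain ⟨C', hC'⟩ := hy.eventually_norm_expSeries_le hb'
  refine Filter.Tendsto.const_mul _ ?_
  refine intervalIntegral.tendsto_integral_filter_of_dominated_convergence (fun _ => C * C')
    (.of_forall fun r => ?_) ?_ intervalIntegrable_const (.of_forall fun θ _ => ?_)
  · have h1 := continuous_expSeries (summable_norm_logCoeff (hx.isNodes r).norm_lt_one (m r))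
    have h2 := continuous_expSeries (summable_norm_logCoeff (hy.isNodes r).norm_lt_one (m' r))
    exact Continuous.aestronglyMeasurable (by fun_prop)
  · filter_upwards [hC, hC'] with r h1 h2
    refine .of_forall fun θ _ => ?_
    have he : ‖Complex.exp (-((k : ℂ) * θ * Complex.I))‖ = 1 := by
      have := Complex.norm_exp_ofReal_mul_I (-(k * θ))
      rw [← this]
      congr 2
      push_cast
      ring
    rw [norm_mul, norm_mul, he, mul_one, norm_star]
    exact mul_le_mul (h1 θ) (h2 θ) (norm_nonneg _) ((norm_nonneg _).trans (h1 θ))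
  · exact ((hx.tendsto_expSeries hb θ).mul ((hy.tendsto_expSeries hb' θ).star)).mul_const _

theorem tendsto_det_expSeriesCoeff {b b' : ℕ → ℂ} (h0 : b 0 = 0) (h0' : b' 0 = 0)
    (hb : Summable fun k => ‖b k‖) (hb' : Summable fun k => ‖b' k‖)
    (hb2 : Summable fun k : ℕ => (k : ℝ) * ‖b k‖ ^ 2)
    (hb2' : Summable fun k : ℕ => (k : ℝ) * ‖b' k‖ ^ 2) :
    Filter.Tendsto
      (fun n => (Matrix.of fun i j : Fin n => expSeriesCoeff b b' ((i : ℤ) - (j : ℤ))).det)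
      Filter.atTop (nhds (Complex.exp (∑' k : ℕ, k * star (b' k) * b k))) := by
  obtain ⟨x, m, hx⟩ := exists_logApproxSeq h0 hb hb2
  obtain ⟨y, m', hy⟩ := exists_logApproxSeq h0' hb' hb2'
  refine tendsto_of_tendsto_toeplitzGram hx hy hb2 hb2' fun n => ?_
  simp_rw [toeplitzGram_eq_det_expSeriesCoeff (hx.isNodes _).norm_lt_one
    (hy.isNodes _).norm_lt_one]
  refine ((Continuous.matrix_det continuous_id).tendsto _).comp ?_
  exact tendsto_pi_nhds.2 fun i => tendsto_pi_nhds.2 fun j =>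
    tendsto_expSeriesCoeff hx hy hb hb' _

theorem exp_tsum_int_eq {b : ℤ → ℂ} (hb : Summable fun k : ℤ => ‖b k‖) (θ : ℝ) :
    Complex.exp (∑' k : ℤ, b k * Complex.exp ((k : ℂ) * θ * Complex.I)) =
      Complex.exp (b 0) * (expSeries (fun k => if k = 0 then 0 else b k) θ *
        star (expSeries (fun k => if k = 0 then 0 else star (b (-k))) θ)) := by
  have hpos : Summable fun k : ℕ => ‖if k = 0 then 0 else b k‖ :=
    .of_nonneg_of_le (fun _ => norm_nonneg _) (fun k => by split_ifs <;> simp)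
      (hb.comp_injective Nat.cast_injective)
  have hneg : Summable fun k : ℕ => ‖if k = 0 then 0 else star (b (-k))‖ :=
    .of_nonneg_of_le (fun _ => norm_nonneg _) (fun k => by split_ifs <;> simp)
      (hb.comp_injective (neg_injective.comp Nat.cast_injective))
  have hs : ∀ {c : ℕ → ℂ}, (Summable fun k => ‖c k‖) →
      HasSum (fun k => c k * Complex.exp (θ * Complex.I) ^ k)
        (∑' k, c k * Complex.exp (θ * Complex.I) ^ k) := fun h =>
    (Summable.of_norm (by simpa only [norm_mul_exp_pow] using h)).hasSum
  have h1 := (hs hpos).add (hasSum_ite_eq (0 : ℕ) (b 0))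
  have h2 := (hs hneg).star.add (hasSum_ite_eq (0 : ℕ) (b 0))
  have e1 : ∀ k : ℕ, (if k = 0 then 0 else b k) * Complex.exp (θ * Complex.I) ^ k +
      (if k = 0 then b 0 else 0) = b (k : ℤ) * Complex.exp (((k : ℤ) : ℂ) * θ * Complex.I) := by
    intro k
    rcases eq_or_ne k 0 with rfl | hk
    · simp
    · rw [if_neg hk, if_neg hk, add_zero, ← Complex.exp_nat_mul, Int.cast_natCast, mul_assoc]
  have e2 : ∀ k : ℕ,
      star ((if k = 0 then 0 else star (b (-k))) * Complex.exp (θ * Complex.I) ^ k) +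
      (if k = 0 then b 0 else 0) =
      b (-(k : ℤ)) * Complex.exp (((-(k : ℤ) : ℤ) : ℂ) * θ * Complex.I) := by
    intro k
    rcases eq_or_ne k 0 with rfl | hk
    · simp
    · rw [if_neg hk, if_neg hk, add_zero, ← Complex.exp_nat_mul, star_mul, star_star, mul_comm,
        RCLike.star_def, ← Complex.exp_conj]
      congr 2
      simp
      ring
  simp_rw [e1] at h1
  simp_rw [e2] at h2
  have h3 := HasSum.of_nat_of_neg (f := fun k : ℤ => b k * Complex.exp ((k : ℂ) * θ * Complex.I))
    h1 h2
  rw [h3.tsum_eq, expSeries, expSeries, RCLike.star_def, ← Complex.exp_conj, ← Complex.exp_add,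
    ← Complex.exp_add]
  congr 1
  simp
  ring

theorem summable_natCast_mul_norm_sq_of_int {b : ℤ → ℂ}
    (hb : Summable fun k : ℤ => (|k| : ℝ) * ‖b k‖ ^ 2) :
    (Summable fun k : ℕ => (k : ℝ) * ‖b k‖ ^ 2) ∧
      Summable fun k : ℕ => (k : ℝ) * ‖b (-k)‖ ^ 2 := by
  have h1 := hb.comp_injective (i := fun k : ℕ => (k : ℤ)) Nat.cast_injective
  have h2 := hb.comp_injective (i := fun k : ℕ => -(k : ℤ))
    (neg_injective.comp Nat.cast_injective)
  exact ⟨by simpa [Function.comp_def] using h1, by simpa [Function.comp_def] using h2⟩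

theorem summable_norm_natCast_mul_mul {c d : ℕ → ℂ}
    (hc : Summable fun k : ℕ => (k : ℝ) * ‖c k‖ ^ 2)
    (hd : Summable fun k : ℕ => (k : ℝ) * ‖d k‖ ^ 2) :
    Summable fun k : ℕ => ‖(k : ℂ) * c k * d k‖ := by
  refine .of_nonneg_of_le (fun _ => norm_nonneg _) (fun k => ?_) (hc.add hd)
  rw [norm_mul, norm_mul, Complex.norm_natCast, mul_assoc, ← mul_add]
  refine mul_le_mul_of_nonneg_left ?_ (Nat.cast_nonneg k)
  nlinarith [sq_nonneg (‖c k‖ - ‖d k‖), mul_nonneg (norm_nonneg (c k)) (norm_nonneg (d k))]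

/-- (Szegő's strong limit theorem, exponential form) Let `b : ℤ → ℂ` with
`∑_k |b_k| < ∞` and `∑_k |k||b_k|² < ∞`; set `f(θ) = exp(∑_k b_k e^{ikθ})`, let
`f_k` be its Fourier coefficients, and let `T_n(f)` be the n×n Toeplitz matrix
`(T_n(f))_{ij} = f_{i−j}`. Then `∑_{k≥1} k b_k b_{−k}` converges absolutely and
`det(T_n(f)) e^{−n b_0} → exp(∑_{k≥1} k b_k b_{−k})` as `n → ∞`. -/
theorem stmt14 (b : ℤ → ℂ)
    (hb1 : Summable fun k : ℤ => ‖b k‖)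
    (hb2 : Summable fun k : ℤ => (|k| : ℝ) * ‖b k‖ ^ 2)
    (f : ℝ → ℂ)
    (hf : ∀ θ : ℝ, f θ = Complex.exp (∑' k : ℤ, b k * Complex.exp ((k : ℂ) * θ * Complex.I)))
    (fc : ℤ → ℂ)
    (hfc : ∀ k : ℤ, fc k =
      (1 / (2 * Real.pi)) *
        ∫ θ in (-Real.pi : ℝ)..Real.pi, f θ * Complex.exp (-((k : ℂ) * θ * Complex.I)))
    (T : (n : ℕ) → Matrix (Fin n) (Fin n) ℂ)
    (hT : ∀ (n : ℕ) (i j : Fin n), T n i j = fc ((i : ℤ) - (j : ℤ))) :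
    (Summable fun k : ℕ => ‖(k : ℂ) * b (k : ℤ) * b (-(k : ℤ))‖) ∧
    Filter.Tendsto (fun n : ℕ => (T n).det * Complex.exp (-(n : ℂ) * b 0)) Filter.atTop
      (nhds (Complex.exp (∑' k : ℕ, (k : ℂ) * b (k : ℤ) * b (-(k : ℤ))))) := by
  obtain ⟨hpos, hneg⟩ := summable_natCast_mul_norm_sq_of_int hb2
  refine ⟨summable_norm_natCast_mul_mul (c := fun k : ℕ => b k) (d := fun k : ℕ => b (-k))
    hpos hneg, ?_⟩
  set c : ℕ → ℂ := fun k => if k = 0 then 0 else b k with hc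
  set d : ℕ → ℂ := fun k => if k = 0 then 0 else star (b (-k)) with hd
  have hc1 : Summable fun k => ‖c k‖ :=
    .of_nonneg_of_le (fun _ => norm_nonneg _) (fun k => by simp only [hc]; split_ifs <;> simp)
      (hb1.comp_injective Nat.cast_injective)
  have hd1 : Summable fun k => ‖d k‖ :=
    .of_nonneg_of_le (fun _ => norm_nonneg _) (fun k => by simp only [hd]; split_ifs <;> simp)
      (hb1.comp_injective (neg_injective.comp Nat.cast_injective))
  have hc2 : Summable fun k : ℕ => (k : ℝ) * ‖c k‖ ^ 2 :=
    hpos.congr fun k => by rcases eq_or_ne k 0 with rfl | hk <;> simp [*]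
  have hd2 : Summable fun k : ℕ => (k : ℝ) * ‖d k‖ ^ 2 :=
    hneg.congr fun k => by rcases eq_or_ne k 0 with rfl | hk <;> simp [*]
  have hcoeff : ∀ k, fc k = Complex.exp (b 0) * expSeriesCoeff c d k := by
    intro k
    rw [hfc, expSeriesCoeff, mul_left_comm]
    congr 1
    rw [← intervalIntegral.integral_const_mul]
    refine intervalIntegral.integral_congr fun θ _ => ?_
    simp only [hf, hc, hd]
    rw [exp_tsum_int_eq hb1]
    ring
  have hdet : ∀ n : ℕ, (T n).det * Complex.exp (-(n : ℂ) * b 0) =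
      (Matrix.of fun i j : Fin n => expSeriesCoeff c d ((i : ℤ) - (j : ℤ))).det := by
    intro n
    have hTn : T n = Complex.exp (b 0) •
        Matrix.of fun i j : Fin n => expSeriesCoeff c d ((i : ℤ) - (j : ℤ)) := by
      ext i j
      rw [hT, hcoeff, Matrix.smul_apply, Matrix.of_apply, smul_eq_mul]
    rw [hTn, Matrix.det_smul, Fintype.card_fin, ← Complex.exp_nat_mul, mul_right_comm,
      ← Complex.exp_add, neg_mul, add_neg_cancel, Complex.exp_zero, one_mul]
  simp_rw [hdet]
  convert tendsto_det_expSeriesCoeff (by simp [hc]) (by simp [hd]) hc1 hd1 hc2 hd2 using 5 with k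
  rcases eq_or_ne k 0 with rfl | hk
  · simp
  · simp [hc, hd, hk]
    ring
end
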